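/- arXiv:2406.15922 — 6 statements merged into one kernel-verified Lean document; each statement's English description precedes it below -/
import Mathlib

section
/- Let m, n be positive integers and let a₁,…,aₙ ∈ Mₘ(ℤ) be m×m matrices with integer entries, regarded as complex matrices. Define the completely positive map η : Mₘ(ℂ) → Mₘ(ℂ) by η(b) := ∑_{i=1}^n aᵢ b aᵢ*. If η is rank non-decreasing, then det(η(b)) ≥ 1 for every positive definite b ∈ Mₘ(ℂ) with det(b) = 1; equivalently, cap(η) ≥ 1. -/
open ComplexOrder Matrix

/-- The capacity of a map `η` on `m × m` complex matrices:
`cap(η) = inf { det(η(b)) : b positive definite, det(b) = 1 }`,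
where `det(η(b))` is read off as the (real) value `(det (η b)).re`
(for positive maps `η`, `det (η b)` is a nonnegative real number). -/
noncomputable def cap {m : ℕ}
    (η : Matrix (Fin m) (Fin m) ℂ → Matrix (Fin m) (Fin m) ℂ) : ℝ :=
  sInf { x : ℝ | ∃ b : Matrix (Fin m) (Fin m) ℂ,
    b.PosDef ∧ b.det = 1 ∧ ((η b).det).re = x }

section GramDeterminant

variable {H H' : Type*} [NormedAddCommGroup H] [InnerProductSpace ℂ H]
  [NormedAddCommGroup H'] [InnerProductSpace ℂ H']
  {ι κ : Type*} [Fintype ι] [DecidableEq ι] [Fintype κ] [DecidableEq κ]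

/-- The determinant of the Gram matrix of a finite family of vectors, as a real number. -/
noncomputable def gramDet (v : ι → H) : ℝ := (gram ℂ v).det.re

theorem coe_gramDet (v : ι → H) : (gramDet v : ℂ) = (gram ℂ v).det := by
  have h := (posSemidef_gram ℂ v).det_nonneg
  exact Complex.ext rfl (by simpa using (Complex.le_def.1 h).2)

theorem gramDet_nonneg (v : ι → H) : 0 ≤ gramDet v :=
  (Complex.le_def.1 (posSemidef_gram ℂ v).det_nonneg).1

theorem gramDet_pos {v : ι → H} (hv : LinearIndependent ℂ v) : 0 < gramDet v :=
  (Complex.lt_def.1 (posDef_gram_of_linearIndependent hv).det_pos).1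

theorem gramDet_of_isEmpty [IsEmpty ι] (v : ι → H) : gramDet v = 1 := by
  simp [gramDet]

theorem gramDet_comp_equiv (e : κ ≃ ι) (v : ι → H) : gramDet (v ∘ e) = gramDet v := by
  have : gram ℂ (v ∘ e) = (gram ℂ v).submatrix e e := rfl
  rw [gramDet, this, det_submatrix_equiv_self, gramDet]

theorem gramDet_sum_smul (T : Matrix ι ι ℂ) (u : ι → H) :
    gramDet (fun j => ∑ i, T i j • u i) = Complex.normSq T.det * gramDet u := by
  have h : gram ℂ (fun j => ∑ i, T i j • u i) = Tᴴ * gram ℂ u * T := by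
    ext j k
    simp only [gram_apply, sum_inner, inner_sum, inner_smul_left, inner_smul_right, mul_apply,
      conjTranspose_apply, Finset.sum_mul, Finset.mul_sum]
    exact Finset.sum_congr rfl fun _ _ => Finset.sum_congr rfl fun _ _ => by
      simp; ring
  have h2 : ((gramDet (fun j => ∑ i, T i j • u i) : ℝ) : ℂ)
      = ((Complex.normSq T.det * gramDet u : ℝ) : ℂ) := by
    rw [coe_gramDet, h, det_mul, det_mul, det_conjTranspose, Complex.ofReal_mul, coe_gramDet,
      Complex.normSq_eq_conj_mul_self]
    simp; ring
  exact_mod_cast h2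

theorem gramDet_sumElim_of_orthogonal (u : ι → H) (v : κ → H)
    (h : ∀ i j, inner ℂ (u i) (v j) = 0) :
    gramDet (Sum.elim u v) = gramDet u * gramDet v := by
  have hb : gram ℂ (Sum.elim u v) = fromBlocks (gram ℂ u) 0 0 (gram ℂ v) := by
    ext (i | i) (j | j) <;> simp [gram_apply, h, inner_eq_zero_symm.1 (h _ _)]
  have h2 : ((gramDet (Sum.elim u v) : ℝ) : ℂ) = ((gramDet u * gramDet v : ℝ) : ℂ) := by
    rw [coe_gramDet, hb, det_fromBlocks_zero₂₁, Complex.ofReal_mul, coe_gramDet, coe_gramDet]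
  exact_mod_cast h2

theorem gramDet_sumElim [FiniteDimensional ℂ H] (u : ι → H) (v : κ → H) :
    gramDet (Sum.elim u v) =
      gramDet u * gramDet fun j => (Submodule.span ℂ (Set.range u))ᗮ.starProjection (v j) := by
  set K := Submodule.span ℂ (Set.range u)
  have hc : ∀ j, ∃ c : ι → ℂ, ∑ i, c i • u i = K.starProjection (v j) := fun j =>
    (Submodule.mem_span_range_iff_exists_fun ℂ).1 (K.starProjection_apply_mem (v j))
  choose c hc using hc
  rw [← gramDet_sumElim_of_orthogonal u]
  · have hT := gramDet_sum_smul (fromBlocks 1 (of fun i j => c j i) 0 1 : Matrix (ι ⊕ κ) (ι ⊕ κ) ℂ)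
      (Sum.elim u fun j => Kᗮ.starProjection (v j))
    rw [det_fromBlocks_zero₂₁] at hT
    simp only [det_one, mul_one, map_one, one_mul] at hT
    rw [← hT]
    congr 1
    ext (i | j)
    · simp [one_apply]
    · simp [one_apply, hc, Submodule.starProjection_orthogonal]
  · intro i j
    exact Submodule.inner_right_of_mem_orthogonal
      (Submodule.subset_span (Set.mem_range_self i)) (Submodule.starProjection_apply_mem _ _)

theorem Matrix.PosSemidef.one_le_det_one_add {C : Matrix ι ι ℂ} (hC : C.PosSemidef) :
    1 ≤ (1 + C).det := by
  have h := hC.1.spectral_theorem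
  set U := hC.1.eigenvectorUnitary
  have h2 : 1 + C = Unitary.conjStarAlgAut ℂ _ U
      (diagonal fun i => 1 + (hC.1.eigenvalues i : ℂ)) := by
    have : (diagonal fun i => 1 + (hC.1.eigenvalues i : ℂ))
      = 1 + diagonal (RCLike.ofReal ∘ hC.1.eigenvalues) := by
      rw [← diagonal_one, diagonal_add]; rfl
    rw [this, map_add, map_one, ← h]
  rw [h2, Unitary.conjStarAlgAut_apply, det_mul_right_comm]
  rw [← Unitary.coe_star, Unitary.coe_mul_star_self, one_mul, det_diagonal]
  have : (1 : ℝ) ≤ ∏ i, (1 + hC.1.eigenvalues i) :=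
    Finset.prod_const_one.symm.trans_le <| Finset.prod_le_prod (fun _ _ => zero_le_one)
      fun i _ => by linarith [hC.eigenvalues_nonneg i]
  exact_mod_cast this

theorem Matrix.PosSemidef.det_le_det_add {A B : Matrix ι ι ℂ} (hA : A.PosSemidef)
    (hB : B.PosSemidef) : A.det ≤ (A + B).det := by
  by_cases h : A.det = 0
  · rw [h]; exact (hA.add hB).det_nonneg
  have hA' : A.PosDef := hA.posDef_iff_det_ne_zero.2 h
  open scoped MatrixOrder Matrix.Norms.L2Operator in
  obtain ⟨y, hy, rfl⟩ := CStarAlgebra.isStrictlyPositive_iff_eq_star_mul_self.mp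
    hA'.isStrictlyPositive
  have hyd : IsUnit y.det := (isUnit_iff_isUnit_det y).1 hy
  have e : star y * y + B = star y * (1 + (y⁻¹)ᴴ * B * y⁻¹) * y := by
    rw [mul_add, add_mul, mul_one, star_eq_conjTranspose]
    congr 1
    rw [← mul_assoc, ← mul_assoc, ← conjTranspose_mul, nonsing_inv_mul _ hyd, mul_assoc, mul_assoc,
      nonsing_inv_mul _ hyd]
    simp
  have h1 := (hB.conjTranspose_mul_mul_same y⁻¹).one_le_det_one_add
  have h2 := hA.det_nonneg
  rw [e, det_mul_right_comm, det_mul _ (1 + _)]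
  exact le_mul_of_one_le_right h2 h1

theorem gramDet_comp_le (ψ : H →ₗ[ℂ] H') (hψ : ∀ x, ‖ψ x‖ ≤ ‖x‖) (v : ι → H) :
    gramDet (fun i => ψ (v i)) ≤ gramDet v := by
  have hB : (gram ℂ v - gram ℂ (fun i => ψ (v i))).PosSemidef := by
    refine .of_dotProduct_mulVec_nonneg
      ((isHermitian_gram _ _).sub (isHermitian_gram _ _)) fun x => ?_
    rw [sub_mulVec, dotProduct_sub, star_dotProduct_gram_mulVec, star_dotProduct_gram_mulVec,
      inner_self_eq_norm_sq_to_K, inner_self_eq_norm_sq_to_K]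
    have := hψ (∑ i, x i • v i)
    simp only [map_sum, map_smul] at this
    have h2 := pow_le_pow_left₀ (norm_nonneg _) this 2
    rw [sub_nonneg]
    exact_mod_cast h2
  have := (posSemidef_gram ℂ (fun i => ψ (v i))).det_le_det_add hB
  rw [add_sub_cancel] at this
  exact (Complex.le_def.1 this).1

theorem gramDet_mul_gramDet_comp_le [FiniteDimensional ℂ H] (ψ : H →ₗ[ℂ] H')
    (hψ : ∀ x, ‖ψ x‖ ≤ ‖x‖) (u : ι → H) (v : κ → H) (hu : ∀ i, ψ (u i) = 0) :
    gramDet u * gramDet (fun j => ψ (v j)) ≤ gramDet (Sum.elim u v) := by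
  rw [gramDet_sumElim]
  refine mul_le_mul_of_nonneg_left ?_ (gramDet_nonneg u)
  set K := Submodule.span ℂ (Set.range u)
  have hK : K ≤ LinearMap.ker ψ := Submodule.span_le.2 (by rintro _ ⟨i, rfl⟩; exact hu i)
  have h : (fun j => ψ (v j)) = fun j => ψ (Kᗮ.starProjection (v j)) := by
    ext j
    have : ψ (K.starProjection (v j)) = 0 := hK (K.starProjection_apply_mem (v j))
    rw [Submodule.starProjection_orthogonal]
    simp [this]
  rw [h]
  exact gramDet_comp_le ψ hψ _

/-- An integral change of family multiplies the Gram determinant by the square of an integer. -/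
theorem gramDet_sum_zsmul (T : Matrix ι ι ℤ) (u : ι → H) :
    gramDet (fun j => ∑ i, T i j • u i) = (T.det : ℝ) ^ 2 * gramDet u := by
  have := gramDet_sum_smul (T.map (Int.cast : ℤ → ℂ)) u
  have hd : (T.map (Int.cast : ℤ → ℂ)).det = (T.det : ℂ) := ((Int.castRingHom ℂ).map_det T).symm
  rw [hd] at this
  simp only [map_apply, Int.cast_smul_eq_zsmul] at this
  rw [this, ← Complex.ofReal_intCast, Complex.normSq_ofReal, sq]

end GramDeterminant

section LatticeSlicing

variable {H H' : Type*} [NormedAddCommGroup H] [InnerProductSpace ℂ H] [FiniteDimensional ℂ H]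
  [NormedAddCommGroup H'] [InnerProductSpace ℂ H']

theorem gramDet_basis_eq {M ι : Type*} [AddCommGroup M] [Fintype ι] [DecidableEq ι]
    (b b' : Module.Basis ι ℤ M) (f : M →ₗ[ℤ] H') :
    gramDet (fun j => f (b' j)) = gramDet fun i => f (b i) := by
  have h : (fun j => f (b' j)) = fun j => ∑ i, b.toMatrix b' i j • f (b i) := by
    ext j
    simp only [← map_zsmul f, ← map_sum, b.sum_toMatrix_smul_self]
  have hu : IsUnit (b.toMatrix b').det := by
    rw [← Module.Basis.det_apply]; exact b.isUnit_det b'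
  rw [h, gramDet_sum_zsmul]
  rcases Int.isUnit_iff.1 hu with h1 | h1 <;> simp [h1]

/-- Splitting a lattice along the kernel of a map to an orthogonal quotient: if every family in `E`
extending `u` has Gram determinant at least `κ` to the number of added vectors, relative to `u`,
then passing to the sublattice which `α` maps into the span of `u` decreases the Gram determinant
by at least `κ` to the loss of rank. -/
theorem exists_gramDet_slice {E F : Type*} [AddCommGroup E] [AddCommGroup F]
    (Φ : F →ₗ[ℤ] H) (φ : E →ₗ[ℤ] H') (α : F →ₗ[ℤ] E) (π : H →ₗ[ℂ] H')
    [FiniteDimensional ℂ H']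
    (hπ : ∀ x, ‖π x‖ ≤ ‖x‖) (hΦ : ∀ x, π (Φ x) = φ (α x)) {s : ℕ} (u : Fin s → E)
    (hu : LinearIndependent ℤ u) (hpos : 0 < gramDet fun i => φ (u i)) (κ : ℝ)
    (hκ : ∀ (t : ℕ) (v : Fin t → E), LinearIndependent ℤ (Sum.elim u v) →
      (gramDet fun i => φ (u i)) * κ ^ t ≤ gramDet fun i => φ (Sum.elim u v i))
    {q : ℕ} (w : Fin q → F) (hw : LinearIndependent ℤ w) :
    ∃ (q' t : ℕ) (w' : Fin q' → F), q' + t = q ∧ LinearIndependent ℤ w' ∧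
      (∀ j, w' j ∈ Submodule.span ℤ (Set.range w)) ∧
      (∀ j, φ (α (w' j)) ∈ Submodule.span ℂ (Set.range fun i => φ (u i))) ∧
      (gramDet fun i => Φ (w' i)) * κ ^ t ≤ gramDet fun i => Φ (w i) := by
  set U := Submodule.span ℂ (Set.range fun i => φ (u i))
  set M := Submodule.span ℤ (Set.range w)
  let bw : Module.Basis (Fin q) ℤ M := Module.Basis.span hw
  have hbw : ∀ j, (bw j : F) = w j := fun j => congrArg Subtype.val (Module.Basis.span_apply hw j)
  let P : H' →ₗ[ℂ] H' := (Uᗮ.starProjection : H' →L[ℂ] H')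
  have hPU : ∀ x, P x = 0 ↔ x ∈ U := fun x => by
    simp [P, sub_eq_zero, eq_comm (a := x), Submodule.starProjection_eq_self_iff]
  have hPn : ∀ x, ‖P x‖ ≤ ‖x‖ := fun x => Uᗮ.norm_starProjection_apply_le x
  let θ : M →ₗ[ℤ] H' := (P.restrictScalars ℤ) ∘ₗ φ ∘ₗ α ∘ₗ M.subtype
  have hθ : ∀ x : M, θ x = P (φ (α x)) := fun _ => rfl
  have : Module.Finite ℤ M := .of_basis bw
  have : Module.Free ℤ M := .of_basis bw
  have : Module.IsTorsionFree ℤ H' := .trans_faithfulSMul ℤ ℂ H'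
  have : Module.Free ℤ (LinearMap.range θ) := inferInstance
  have : Module.Free ℤ (M ⧸ LinearMap.ker θ) := .of_equiv θ.quotKerEquivRange.symm
  let bK := Module.finBasis ℤ (LinearMap.ker θ)
  let bQ := Module.finBasis ℤ (M ⧸ LinearMap.ker θ)
  let b := bK.sumQuot bQ
  have hinl : ∀ i, b (Sum.inl i) = bK i := fun i => Module.Basis.sumQuot_inl _ _ i
  let e := b.indexEquiv bw
  refine ⟨_, _, fun i => (bK i : M), by simpa using Fintype.card_congr e, ?_,
    fun j => (bK j : M).2, ?_, ?_⟩
  · exact (bK.linearIndependent.map' _ (Submodule.ker_subtype _)).map' M.subtype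
      (Submodule.ker_subtype _)
  · intro j
    rw [← hPU, ← hθ]
    exact (bK j).2
  set v : Fin (Module.finrank ℤ (M ⧸ LinearMap.ker θ)) → E := fun j => α (b (Sum.inr j) : M) with hv
  have hPu : ∀ i, P (φ (u i)) = 0 := fun i => (hPU _).2 (Submodule.subset_span ⟨i, rfl⟩)
  have hLI : LinearIndependent ℤ (Sum.elim u v) := by
    rw [Fintype.linearIndependent_iff]
    intro g hg
    simp only [Fintype.sum_sum_type, Sum.elim_inl, Sum.elim_inr] at hg
    have h1 : θ (∑ j, g (Sum.inr j) • b (Sum.inr j)) = 0 := by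
      have := congrArg (fun x => P (φ x)) hg
      simp only [map_add, map_sum, map_zsmul, hPu, smul_zero, Finset.sum_const_zero, zero_add,
        map_zero] at this
      simpa [map_sum, map_zsmul, hθ, hv] using this
    have h2 : ∑ j, g (Sum.inr j) • bQ j = 0 := by
      have := (Submodule.Quotient.mk_eq_zero (LinearMap.ker θ)).2 (LinearMap.mem_ker.2 h1)
      rw [← Submodule.mkQ_apply, map_sum] at this
      simpa [map_zsmul, b] using this
    have h3 := Fintype.linearIndependent_iff.1 bQ.linearIndependent _ h2
    simp only [h3, zero_smul, Finset.sum_const_zero, add_zero] at hg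
    have h4 := Fintype.linearIndependent_iff.1 hu _ hg
    rintro (i | i)
    · exact h4 i
    · exact h3 i
  have h1 := hκ _ v hLI
  have h2 : (gramDet fun i => φ (Sum.elim u v i)) =
      (gramDet fun i => φ (u i)) * gramDet fun j => P (φ (v j)) := by
    refine Eq.trans ?_ (gramDet_sumElim (fun i => φ (u i)) fun j => φ (v j))
    congr 1
    ext (i | i) <;> rfl
  rw [h2, mul_le_mul_iff_right₀ hpos] at h1
  have h3 := gramDet_mul_gramDet_comp_le (P ∘ₗ π) (fun x => (hPn _).trans (hπ x))
    (fun i => Φ ((bK i : M) : F)) (fun j => Φ (b (Sum.inr j) : M)) (fun i => by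
      rw [LinearMap.comp_apply, hΦ, ← hθ]; exact (bK i).2)
  have h4 : (fun j => (P ∘ₗ π) (Φ (b (Sum.inr j) : M))) = fun j => P (φ (v j)) := by
    ext j
    simp [hΦ, hv]
  have h5 : gramDet (Sum.elim (fun i => Φ ((bK i : M) : F)) fun j => Φ (b (Sum.inr j) : M)) =
      gramDet fun i => Φ (w i) := by
    have h6 : (Sum.elim (fun i => Φ ((bK i : M) : F)) fun j => Φ (b (Sum.inr j) : M)) =
        fun i => (Φ ∘ₗ M.subtype) (b i) := by
      ext (i | i)
      · simp [hinl]
      · rfl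
    rw [h6, gramDet_basis_eq (bw.reindex e.symm) b, ← gramDet_comp_equiv e.symm]
    congr 1
    ext i
    simp [hbw]
  rw [h4, h5] at h3
  exact (mul_le_mul_of_nonneg_left h1 (gramDet_nonneg _)).trans h3

end LatticeSlicing

section SlopeInequality

variable {H : Type*} [NormedAddCommGroup H] [InnerProductSpace ℂ H] [FiniteDimensional ℂ H]
  {E F : Type*} [AddCommGroup E] [AddCommGroup F] {n : ℕ}

/-- The map `x ↦ (φ (α i x))ᵢ` into the orthogonal direct sum of `n` copies of `H`. -/
noncomputable def directSumMap (φ : E →ₗ[ℤ] H) (α : Fin n → F →ₗ[ℤ] E) :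
    F →ₗ[ℤ] PiLp 2 (fun _ : Fin n => H) where
  toFun x := WithLp.toLp 2 fun i => φ (α i x)
  map_add' x y := by ext i; simp
  map_smul' k x := by ext i; simp

theorem exists_gramDet_slice_finset (φ : E →ₗ[ℤ] H) (α : Fin n → F →ₗ[ℤ] E) {s : ℕ}
    (u : Fin s → E) (hu : LinearIndependent ℤ u) (hpos : 0 < gramDet fun i => φ (u i))
    (κ : ℝ) (hκ0 : 0 ≤ κ)
    (hκ : ∀ (t : ℕ) (v : Fin t → E), LinearIndependent ℤ (Sum.elim u v) →
      (gramDet fun i => φ (u i)) * κ ^ t ≤ gramDet fun i => φ (Sum.elim u v i))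
    {q : ℕ} (w : Fin q → F) (hw : LinearIndependent ℤ w) (S : Finset (Fin n)) :
    ∃ (q' t : ℕ) (w' : Fin q' → F), q' + t = q ∧ LinearIndependent ℤ w' ∧
      (∀ j, w' j ∈ Submodule.span ℤ (Set.range w)) ∧
      (∀ i ∈ S, ∀ j, φ (α i (w' j)) ∈ Submodule.span ℂ (Set.range fun i => φ (u i))) ∧
      (gramDet fun i => directSumMap φ α (w' i)) * κ ^ t ≤
        gramDet fun i => directSumMap φ α (w i) := by
  induction S using Finset.induction_on with
  | empty =>
    exact ⟨q, 0, w, rfl, hw, fun j => Submodule.subset_span ⟨j, rfl⟩, by simp, by simp⟩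
  | insert a S _ ih =>
    obtain ⟨q₁, t₁, w₁, hq₁, hw₁, hs₁, hU₁, hG₁⟩ := ih
    obtain ⟨q₂, t₂, w₂, hq₂, hw₂, hs₂, hU₂, hG₂⟩ :=
      exists_gramDet_slice (directSumMap φ α) φ (α a)
        (PiLp.projₗ 2 (fun _ : Fin n => H) a) (fun x => PiLp.norm_apply_le x a)
        (fun _ => rfl) u hu hpos κ hκ w₁ hw₁
    refine ⟨q₂, t₂ + t₁, w₂, by omega, hw₂, fun j => ?_, ?_, ?_⟩
    · exact Submodule.span_le.2 (by rintro _ ⟨i, rfl⟩; exact hs₁ i) (hs₂ j)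
    · intro i hi j
      rcases Finset.mem_insert.1 hi with rfl | hi
      · exact hU₂ j
      · have : Submodule.span ℤ (Set.range w₁) ≤
            ((Submodule.span ℂ (Set.range fun i => φ (u i))).restrictScalars ℤ).comap
              (φ ∘ₗ α i) := Submodule.span_le.2 (by rintro _ ⟨k, rfl⟩; exact hU₁ i hi k)
        exact this (hs₂ j)
    · rw [pow_add, ← mul_assoc]
      exact (mul_le_mul_of_nonneg_right hG₂ (pow_nonneg hκ0 _)).trans hG₁

/-- The slope inequality: if `r` is a vertex of the lower convex hull of the minimal log-covolumes
of sublattices of `E`, with a supporting line of slope `μ`, then every sublattice of the preimage of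
the minimal sublattice of rank `r` has log-covolume bounded below by the line of slope `μ`. -/
theorem exp_slope_le_gramDet (φ : E →ₗ[ℤ] H) (α : Fin n → F →ₗ[ℤ] E) (m : ℕ)
    (hE : ∀ (t : ℕ) (v : Fin t → E), LinearIndependent ℤ v → t ≤ m)
    (hpos : ∀ (t : ℕ) (v : Fin t → E), LinearIndependent ℤ v → 0 < gramDet fun i => φ (v i))
    (u : ∀ r, Fin r → E) (hu : ∀ r ≤ m, LinearIndependent ℤ (u r))
    (hmin : ∀ r ≤ m, ∀ v : Fin r → E, LinearIndependent ℤ v →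
      (gramDet fun i => φ (u r i)) ≤ gramDet fun i => φ (v i))
    (hrank : ∀ r ≤ m, ∀ (q : ℕ) (w : Fin q → F), LinearIndependent ℤ w →
      (∀ i j, φ (α i (w j)) ∈ Submodule.span ℂ (Set.range fun i => φ (u r i))) → q ≤ r)
    (g : ℕ → ℝ) (hg : ∀ r ≤ m, Real.exp (g r) = gramDet fun i => φ (u r i)) :
    ∀ r ≤ m, ∀ μ : ℝ, (∀ s ≤ m, g r - μ * r ≤ g s - μ * s) →
      ∀ (q : ℕ) (w : Fin q → F), LinearIndependent ℤ w →
        (∀ i j, φ (α i (w j)) ∈ Submodule.span ℂ (Set.range fun i => φ (u r i))) →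
        Real.exp (g r + μ * (q - r)) ≤ gramDet fun i => directSumMap φ α (w i) := by
  intro r
  induction r using Nat.strong_induction_on with
  | _ r ih =>
  intro hr μ hμ q w hw hwU
  have hqr := hrank r hr q w hw hwU
  rcases Nat.eq_zero_or_pos r with rfl | hr0
  · obtain rfl : q = 0 := by omega
    simp [gramDet_of_isEmpty, hg 0 hr]
  obtain ⟨s, hs, hsmax⟩ := Finset.exists_max_image (Finset.range r)
    (fun s => (g r - g s) / ((r : ℝ) - s)) ⟨0, by simpa using hr0⟩
  rw [Finset.mem_range] at hs
  have hsm : s ≤ m := by omega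
  have hrs : (0 : ℝ) < r - s := by
    have : (s : ℝ) < r := by exact_mod_cast hs
    linarith
  set ν := (g r - g s) / ((r : ℝ) - s) with hν
  have hνs : g r - g s = ν * (r - s) := by rw [hν]; field_simp
  have hνμ : ν ≤ μ := by
    rw [hν, div_le_iff₀ hrs]
    linarith [hμ s hsm]
  have hνmin : ∀ t ≤ m, g s - ν * s ≤ g t - ν * t := by
    intro t ht
    rcases lt_or_ge t r with h | h
    · have h1 := hsmax t (Finset.mem_range.2 h)
      have hrt : (0 : ℝ) < r - t := by
        have : (t : ℝ) < r := by exact_mod_cast h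
        linarith
      rw [div_le_iff₀ hrt] at h1
      linarith
    · have h1 := hμ t ht
      have h2 : (r : ℝ) ≤ t := by exact_mod_cast h
      nlinarith
  have hκ : ∀ (t : ℕ) (v : Fin t → E), LinearIndependent ℤ (Sum.elim (u s) v) →
      (gramDet fun i => φ (u s i)) * Real.exp ν ^ t ≤
        gramDet fun i => φ (Sum.elim (u s) v i) := by
    intro t v hv
    have hv' : LinearIndependent ℤ (Sum.elim (u s) v ∘ finSumFinEquiv.symm) :=
      hv.comp _ finSumFinEquiv.symm.injective
    have hst := hE _ _ hv'
    have h1 := hmin _ hst _ hv'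
    have h2 : (gramDet fun i => φ ((Sum.elim (u s) v ∘ finSumFinEquiv.symm) i)) =
        gramDet fun i => φ (Sum.elim (u s) v i) :=
      gramDet_comp_equiv finSumFinEquiv.symm fun i => φ (Sum.elim (u s) v i)
    rw [h2, ← hg _ hst] at h1
    refine le_trans ?_ h1
    rw [← hg s hsm, ← Real.exp_nat_mul, ← Real.exp_add, Real.exp_le_exp]
    have := hνmin _ hst
    push_cast at this
    linarith
  obtain ⟨q', t, w', hq, hw', -, hU', hG⟩ := exists_gramDet_slice_finset φ α (u s) (hu s hsm)
    (hpos _ _ (hu s hsm)) _ (Real.exp_pos ν).le hκ w hw Finset.univ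
  have h1 := ih s hs hsm ν hνmin q' w' hw' fun i j => hU' i (Finset.mem_univ i) j
  refine le_trans ?_ ((mul_le_mul_of_nonneg_right h1 (pow_nonneg (Real.exp_pos ν).le t)).trans hG)
  rw [← Real.exp_nat_mul, ← Real.exp_add, Real.exp_le_exp]
  have hq' : (q : ℝ) = q' + t := by exact_mod_cast hq.symm
  have hqr' : (q : ℝ) ≤ r := by exact_mod_cast hqr
  have h3 : 0 ≤ (μ - ν) * (r - q) := mul_nonneg (by linarith) (by linarith)
  rw [hq'] at h3 ⊢
  linarith

end SlopeInequality

section IntegralKrausMap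

variable {m n : ℕ}

theorem gramDet_basisFun_le_directSumMap {H : Type*} [NormedAddCommGroup H]
    [InnerProductSpace ℂ H] [FiniteDimensional ℂ H] (hH : Module.finrank ℂ H = m)
    (φ : (Fin m → ℤ) →ₗ[ℤ] H) (α : Fin n → (Fin m → ℤ) →ₗ[ℤ] (Fin m → ℤ))
    (hφ : ∀ (r : ℕ) (v : Fin r → Fin m → ℤ), LinearIndependent ℤ v →
      LinearIndependent ℂ fun i => φ (v i))
    (hnat : ∀ (r : ℕ) (v : Fin r → Fin m → ℤ), ∃ k : ℕ, (gramDet fun i => φ (v i)) = k)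
    (hrank : ∀ (U : Submodule ℂ H) (q : ℕ) (w : Fin q → Fin m → ℤ), LinearIndependent ℤ w →
      (∀ i j, φ (α i (w j)) ∈ U) → q ≤ Module.finrank ℂ U) :
    (gramDet fun j => φ (Pi.basisFun ℤ (Fin m) j)) ≤
      gramDet fun j => directSumMap φ α (Pi.basisFun ℤ (Fin m) j) := by
  classical
  have hpos : ∀ (t : ℕ) (v : Fin t → Fin m → ℤ), LinearIndependent ℤ v →
      0 < gramDet fun i => φ (v i) := fun t v hv => gramDet_pos (hφ t v hv)
  have hex : ∀ r, ∃ u : Fin r → Fin m → ℤ, r ≤ m → LinearIndependent ℤ u ∧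
      ∀ v : Fin r → Fin m → ℤ, LinearIndependent ℤ v →
        (gramDet fun i => φ (u i)) ≤ gramDet fun i => φ (v i) := by
    intro r
    by_cases hr : r ≤ m
    · have hne : ∃ k : ℕ, ∃ v : Fin r → Fin m → ℤ, LinearIndependent ℤ v ∧
          (gramDet fun i => φ (v i)) = k := by
        have hli := (Pi.basisFun ℤ (Fin m)).linearIndependent.comp _ (Fin.castLE_injective hr)
        obtain ⟨k, hk⟩ := hnat r (Pi.basisFun ℤ (Fin m) ∘ Fin.castLE hr)
        exact ⟨k, _, hli, hk⟩
      obtain ⟨u, hu, hk⟩ := Nat.find_spec hne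
      refine ⟨u, fun _ => ⟨hu, fun v hv => ?_⟩⟩
      obtain ⟨k, hk'⟩ := hnat r v
      rw [hk, hk']
      exact_mod_cast Nat.find_min' hne ⟨v, hv, hk'⟩
    · exact ⟨0, fun h => absurd h hr⟩
  choose u hu using hex
  have hg : ∀ r ≤ m, Real.exp (Real.log (gramDet fun i => φ (u r i))) =
      gramDet fun i => φ (u r i) := fun r hr => Real.exp_log (hpos r _ (hu r hr).1)
  set g : ℕ → ℝ := fun r => Real.log (gramDet fun i => φ (u r i))
  obtain ⟨μ, hμ⟩ := Finset.exists_le ((Finset.range m).image fun s => (g m - g s) / ((m : ℝ) - s))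
  have hμ' : ∀ s ≤ m, g m - μ * m ≤ g s - μ * s := by
    intro s hs
    rcases hs.eq_or_lt with rfl | hs
    · rfl
    have h1 := hμ _ (Finset.mem_image_of_mem _ (Finset.mem_range.2 hs))
    have h2 : (0 : ℝ) < m - s := by
      have : (s : ℝ) < m := by exact_mod_cast hs
      linarith
    rw [div_le_iff₀ h2] at h1
    linarith
  have hE : ∀ (t : ℕ) (v : Fin t → Fin m → ℤ), LinearIndependent ℤ v → t ≤ m := by
    intro t v hv
    simpa using hv.fintype_card_le_finrank
  have htop : Submodule.span ℂ (Set.range fun i => φ (u m i)) = ⊤ :=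
    (hφ m _ (hu m le_rfl).1).span_eq_top_of_card_eq_finrank' (by simp [hH])
  have key := exp_slope_le_gramDet φ α m hE hpos u (fun r hr => (hu r hr).1)
    (fun r hr => (hu r hr).2)
    (fun r hr q w hw hU => (hrank _ q w hw hU).trans
      ((finrank_range_le_card _).trans_eq (Fintype.card_fin r)))
    g hg m le_rfl μ hμ' m (fun j => Pi.basisFun ℤ (Fin m) j)
    (Pi.basisFun ℤ (Fin m)).linearIndependent (fun i j => by rw [htop]; trivial)
  rw [sub_self, mul_zero, add_zero, hg m le_rfl] at key
  refine le_trans ?_ key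
  have h1 : (fun j => φ (u m j)) = fun j => ∑ i, (Pi.basisFun ℤ (Fin m)).toMatrix (u m) i j •
      φ (Pi.basisFun ℤ (Fin m) i) := by
    ext j
    simp only [← map_zsmul φ, ← map_sum, Module.Basis.sum_toMatrix_smul_self]
  have h2 := hpos m _ (hu m le_rfl).1
  rw [h1, gramDet_sum_zsmul] at h2 ⊢
  have h3 : ((Pi.basisFun ℤ (Fin m)).toMatrix (u m)).det ≠ 0 := by
    intro h; simp [h] at h2
  have h4 : (1 : ℝ) ≤ (((Pi.basisFun ℤ (Fin m)).toMatrix (u m)).det : ℝ) ^ 2 := by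
    have := Int.one_le_abs h3
    rw [← sq_abs]
    exact one_le_pow₀ (by exact_mod_cast this)
  exact le_mul_of_one_le_left (gramDet_nonneg _) h4

/-- The completely positive map `b ↦ ∑ aᵢ b aᵢ*` with integral Kraus operators. -/
noncomputable def krausMap (a : Fin n → Matrix (Fin m) (Fin m) ℤ) (b : Matrix (Fin m) (Fin m) ℂ) :
    Matrix (Fin m) (Fin m) ℂ :=
  ∑ i, ((a i).map (Int.cast : ℤ → ℂ)) * b * ((a i).map (Int.cast : ℤ → ℂ))ᴴ

theorem conjTranspose_map_intCast (A : Matrix (Fin m) (Fin m) ℤ) :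
    (A.map (Int.cast : ℤ → ℂ))ᴴ = Aᵀ.map (Int.cast : ℤ → ℂ) := by
  ext i j; simp

theorem posSemidef_krausMap (a : Fin n → Matrix (Fin m) (Fin m) ℤ) {b : Matrix (Fin m) (Fin m) ℂ}
    (hb : b.PosSemidef) : (krausMap a b).PosSemidef :=
  posSemidef_sum _ fun _ _ => hb.mul_mul_conjTranspose_same _

theorem gram_toLp_mulVec {r k : ℕ} (c : Matrix (Fin m) (Fin k) ℂ) (v : Fin r → Fin k → ℂ) :
    gram ℂ (fun j => WithLp.toLp 2 (c *ᵥ v j)) = (c * (of v)ᵀ)ᴴ * (c * (of v)ᵀ) := by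
  have : ∀ j, c *ᵥ v j = (c * (of v)ᵀ).col j := fun j => by
    ext i; simp [mulVec, dotProduct, mul_apply]
  ext j k
  simp only [this, gram_apply, EuclideanSpace.inner_eq_star_dotProduct, mul_apply, dotProduct,
    conjTranspose_apply, col_apply, Pi.star_apply]
  exact Finset.sum_congr rfl fun _ _ => mul_comm _ _

/-- The embedding of `ℤᵐ` into Hermitian space as the lattice spanned by the columns of `c`. -/
noncomputable def columnLattice (c : Matrix (Fin m) (Fin m) ℂ) :
    (Fin m → ℤ) →ₗ[ℤ] EuclideanSpace ℂ (Fin m) where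
  toFun x := WithLp.toLp 2 (c *ᵥ fun i => (x i : ℂ))
  map_add' x y := by
    rw [← WithLp.toLp_add, ← mulVec_add]; congr; ext; simp
  map_smul' k x := by
    rw [eq_intCast, Int.cast_id, ← Int.cast_smul_eq_zsmul ℂ k (WithLp.toLp 2 _), ← WithLp.toLp_smul,
      ← mulVec_smul]
    congr; ext; simp

theorem gramDet_columnLattice_nat (C : Matrix (Fin m) (Fin m) GaussianInt) {r : ℕ}
    (v : Fin r → Fin m → ℤ) :
    ∃ k : ℕ, (gramDet fun i => columnLattice (C.map GaussianInt.toComplex) (v i)) = k := by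
  let V : Matrix (Fin m) (Fin r) GaussianInt := of fun i j => (v j i : GaussianInt)
  have hV : (of fun j i => (v j i : ℂ))ᵀ = V.map GaussianInt.toComplex := by
    ext i j; simp [V]
  have hct : ∀ A : Matrix (Fin m) (Fin r) GaussianInt,
      (A.map GaussianInt.toComplex)ᴴ = Aᴴ.map GaussianInt.toComplex := fun A => by
    ext i j; simp [GaussianInt.toComplex_star]
  have h : gram ℂ (fun i => columnLattice (C.map GaussianInt.toComplex) (v i)) =
      ((C * V)ᴴ * (C * V)).map GaussianInt.toComplex := by
    refine (gram_toLp_mulVec _ fun j i => (v j i : ℂ)).trans ?_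
    rw [hV, ← Matrix.map_mul, hct, ← Matrix.map_mul]
  have h2 : (gramDet fun i => columnLattice (C.map GaussianInt.toComplex) (v i)) =
      ((((C * V)ᴴ * (C * V)).det.re : ℤ) : ℝ) := by
    rw [gramDet, h]
    have := (GaussianInt.toComplex.map_det ((C * V)ᴴ * (C * V))).symm
    simp only [RingHom.mapMatrix_apply] at this
    rw [this, GaussianInt.intCast_re]
  have h3 : 0 ≤ ((C * V)ᴴ * (C * V)).det.re := by
    have := gramDet_nonneg fun i => columnLattice (C.map GaussianInt.toComplex) (v i)
    rw [h2] at this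
    exact_mod_cast this
  exact ⟨((C * V)ᴴ * (C * V)).det.re.toNat, by
    rw [h2]; exact_mod_cast (Int.toNat_of_nonneg h3).symm⟩

theorem linearIndependent_columnLattice {c : Matrix (Fin m) (Fin m) ℂ} (hc : IsUnit c) {r : ℕ}
    {v : Fin r → Fin m → ℤ} (hv : LinearIndependent ℤ v) :
    LinearIndependent ℂ fun i => columnLattice c (v i) := by
  have h1 : LinearIndependent ℂ fun i => (algebraMap ℤ ℂ) ∘ v i :=
    linearIndependent_algebraMap_comp_iff.2 hv
  have h2 := h1.map' c.mulVecLin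
    (LinearMap.ker_eq_bot.2 (mulVec_injective_of_isUnit hc))
  exact h2.map' (WithLp.linearEquiv 2 ℂ (Fin m → ℂ)).symm.toLinearMap (LinearEquiv.ker _)

/-- A rank non-decreasing map has, for every subspace `K`, at most `dim K` dimensions of vectors
sent into `K` by all adjoint Kraus operators. -/
theorem card_le_finrank_of_rank_le (a : Fin n → Matrix (Fin m) (Fin m) ℤ)
    (hrank : ∀ b : Matrix (Fin m) (Fin m) ℂ, b.PosSemidef → b.rank ≤ (krausMap a b).rank)
    (K : Submodule ℂ (Fin m → ℂ)) {q : ℕ} {w : Fin q → Fin m → ℂ} (hw : LinearIndependent ℂ w)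
    (hK : ∀ i j, ((a i).map (Int.cast : ℤ → ℂ))ᴴ *ᵥ w j ∈ K) : q ≤ Module.finrank ℂ K := by
  obtain ⟨K', hK'⟩ := K.exists_isCompl
  set D : Matrix (Fin m) (Fin m) ℂ := LinearMap.toMatrix' (K'.projection K hK'.symm) with hD
  have hker : LinearMap.ker D.mulVecLin = K := by
    rw [hD, ← toLin'_apply', toLin'_toMatrix']
    simp
  have h1 := hrank (Dᴴ * D) (posSemidef_conjTranspose_mul_self D)
  rw [rank_conjTranspose_mul_self] at h1
  have h2 : Submodule.span ℂ (Set.range w) ≤ LinearMap.ker (krausMap a (Dᴴ * D)).mulVecLin := by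
    refine Submodule.span_le.2 ?_
    rintro _ ⟨j, rfl⟩
    have : ∀ i, D *ᵥ (((a i).map (Int.cast : ℤ → ℂ))ᴴ *ᵥ w j) = 0 := fun i => by
      have := hK i j
      rw [← hker] at this
      exact this
    simp [krausMap, this]
  have h3 := Submodule.finrank_mono h2
  rw [finrank_span_eq_card hw, Fintype.card_fin] at h3
  have h4 := LinearMap.finrank_range_add_finrank_ker D.mulVecLin
  have h5 := LinearMap.finrank_range_add_finrank_ker (krausMap a (Dᴴ * D)).mulVecLin
  rw [hker] at h4
  simp only [Module.finrank_fintype_fun_eq_card, Fintype.card_fin] at h4 h5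
  rw [Matrix.rank, Matrix.rank] at h1
  omega

theorem det_re_le_krausMap_gaussianInt (a : Fin n → Matrix (Fin m) (Fin m) ℤ)
    (hrank : ∀ b : Matrix (Fin m) (Fin m) ℂ, b.PosSemidef → b.rank ≤ (krausMap a b).rank)
    (C : Matrix (Fin m) (Fin m) GaussianInt) :
    ((C.map GaussianInt.toComplex)ᴴ * C.map GaussianInt.toComplex).det.re ≤
      (krausMap a ((C.map GaussianInt.toComplex)ᴴ * C.map GaussianInt.toComplex)).det.re := by
  set c := C.map GaussianInt.toComplex with hc
  by_cases h0 : c.det = 0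
  · rw [det_mul, h0, mul_zero]
    exact (Complex.le_def.1
      (posSemidef_krausMap a (posSemidef_conjTranspose_mul_self c)).det_nonneg).1
  have hcu : IsUnit c := (isUnit_iff_isUnit_det c).2 (isUnit_iff_ne_zero.2 h0)
  have hcast : ∀ (A : Matrix (Fin m) (Fin m) ℤ) (x : Fin m → ℤ),
      (fun k => ((A *ᵥ x) k : ℂ)) = A.map (Int.cast : ℤ → ℂ) *ᵥ fun k => (x k : ℂ) := by
    intro A x; ext k; simp [mulVec, dotProduct]
  have hbasis : ∀ j, (fun i => ((Pi.basisFun ℤ (Fin m) j) i : ℂ)) = Pi.single j 1 := by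
    intro j; ext i; simp [Pi.single_apply]
  have key := gramDet_basisFun_le_directSumMap (by simp) (columnLattice c)
    (fun i => (a i)ᵀ.mulVecLin) (fun r v => linearIndependent_columnLattice hcu)
    (fun r v => gramDet_columnLattice_nat C v) ?_
  · have h1 : gram ℂ (fun j => columnLattice c (Pi.basisFun ℤ (Fin m) j)) = cᴴ * c := by
      refine (gram_toLp_mulVec c fun j i => ((Pi.basisFun ℤ (Fin m) j) i : ℂ)).trans ?_
      have : (of fun j i => ((Pi.basisFun ℤ (Fin m) j) i : ℂ))ᵀ = 1 := by
        ext i j; simp [Pi.single_apply, one_apply]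
      rw [this, mul_one]
    have h2 : gram ℂ (fun j => directSumMap (columnLattice c) (fun i => (a i)ᵀ.mulVecLin)
        (Pi.basisFun ℤ (Fin m) j)) = krausMap a (cᴴ * c) := by
      ext j k
      rw [gram_apply, PiLp.inner_apply, krausMap, Matrix.sum_apply]
      refine Finset.sum_congr rfl fun i _ => ?_
      have h3 := gram_toLp_mulVec c
        fun j => (a i)ᵀ.map (Int.cast : ℤ → ℂ) *ᵥ (Pi.single j 1 : Fin m → ℂ)
      have h4 : (of fun j => (a i)ᵀ.map (Int.cast : ℤ → ℂ) *ᵥ (Pi.single j 1 : Fin m → ℂ))ᵀ =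
          ((a i).map (Int.cast : ℤ → ℂ))ᴴ := by
        ext k l; simp
      rw [h4, conjTranspose_mul, conjTranspose_conjTranspose] at h3
      have h5 := congrFun (congrFun h3 j) k
      rw [gram_apply] at h5
      simp only [mul_assoc] at h5 ⊢
      rw [← h5]
      simp only [directSumMap, columnLattice, LinearMap.coe_mk, AddHom.coe_mk, mulVecLin_apply,
        hcast, hbasis]
    rwa [gramDet, gramDet, h1, h2] at key
  · intro U q w hw hU
    let L : (Fin m → ℂ) ≃ₗ[ℂ] EuclideanSpace ℂ (Fin m) :=
      (LinearEquiv.ofInjectiveEndo c.mulVecLin (mulVec_injective_of_isUnit hcu)).trans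
        (WithLp.linearEquiv 2 ℂ (Fin m → ℂ)).symm
    have hw' : LinearIndependent ℂ fun i => (algebraMap ℤ ℂ) ∘ w i :=
      linearIndependent_algebraMap_comp_iff.2 hw
    have h1 := card_le_finrank_of_rank_le a hrank (U.comap L.toLinearMap) hw' (fun i j => by
      have := hU i j
      rw [conjTranspose_map_intCast]
      simp only [columnLattice, LinearMap.coe_mk, AddHom.coe_mk, mulVecLin_apply, hcast] at this
      exact this)
    refine h1.trans_eq ?_
    rw [Submodule.comap_equiv_eq_map_symm]
    exact LinearEquiv.finrank_map_eq L.symm U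

theorem krausMap_smul (a : Fin n → Matrix (Fin m) (Fin m) ℤ) (t : ℂ)
    (b : Matrix (Fin m) (Fin m) ℂ) : krausMap a (t • b) = t • krausMap a b := by
  simp [krausMap, Finset.smul_sum]

open Filter Topology in
theorem exists_gaussianInt_approximation (y : Matrix (Fin m) (Fin m) ℂ) :
    ∃ C : ℕ → Matrix (Fin m) (Fin m) GaussianInt,
      Tendsto (fun k : ℕ => ((k : ℝ)⁻¹ : ℂ) • (C k).map GaussianInt.toComplex) atTop (𝓝 y) := by
  refine ⟨fun k => of fun i j => ⟨⌊(y i j).re * k⌋, ⌊(y i j).im * k⌋⟩, ?_⟩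
  refine tendsto_pi_nhds.2 fun i => tendsto_pi_nhds.2 fun j => ?_
  have h : ∀ x : ℝ, Tendsto (fun k : ℕ => ((⌊x * k⌋ : ℤ) : ℝ) / k) atTop (𝓝 x) := by
    intro x
    have h1 : Tendsto (fun k : ℕ => x - (k : ℝ)⁻¹) atTop (𝓝 x) := by
      simpa using tendsto_const_nhds.sub (tendsto_inv_atTop_nhds_zero_nat (𝕜 := ℝ))
    refine tendsto_of_tendsto_of_tendsto_of_le_of_le' h1 tendsto_const_nhds ?_ ?_
    all_goals
      filter_upwards [eventually_gt_atTop 0] with k hk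
      have hk' : (0 : ℝ) < k := by exact_mod_cast hk
    · rw [le_div_iff₀ hk', sub_mul, inv_mul_cancel₀ hk'.ne']
      exact (Int.sub_one_lt_floor _).le
    · rw [div_le_iff₀ hk']
      exact Int.floor_le _
  have h2 := (Complex.continuous_ofReal.tendsto _).comp (h (y i j).re)
  have h3 := (Complex.continuous_ofReal.tendsto _).comp (h (y i j).im)
  have h4 := h2.add (h3.mul_const Complex.I)
  rw [Complex.re_add_im] at h4
  refine h4.congr fun k => ?_
  simp [GaussianInt.toComplex_def]
  ring

theorem det_re_le_krausMap (a : Fin n → Matrix (Fin m) (Fin m) ℤ)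
    (hrank : ∀ b : Matrix (Fin m) (Fin m) ℂ, b.PosSemidef → b.rank ≤ (krausMap a b).rank)
    (y : Matrix (Fin m) (Fin m) ℂ) : (yᴴ * y).det.re ≤ (krausMap a (yᴴ * y)).det.re := by
  obtain ⟨C, hC⟩ := exists_gaussianInt_approximation y
  have hk : Continuous fun z : Matrix (Fin m) (Fin m) ℂ => (krausMap a (zᴴ * z)).det.re := by
    exact Complex.continuous_re.comp (Continuous.matrix_det (continuous_finsetSum _ fun i _ =>
      (continuous_const.matrix_mul (continuous_id.matrix_conjTranspose.matrix_mul
        continuous_id)).matrix_mul continuous_const))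
  have hl : Continuous fun z : Matrix (Fin m) (Fin m) ℂ => (zᴴ * z).det.re :=
    Complex.continuous_re.comp
      (continuous_id.matrix_conjTranspose.matrix_mul continuous_id).matrix_det
  refine le_of_tendsto_of_tendsto' ((hl.tendsto y).comp hC) ((hk.tendsto y).comp hC) fun k => ?_
  have h := det_re_le_krausMap_gaussianInt a hrank (C k)
  have hs : ∀ z : Matrix (Fin m) (Fin m) ℂ, (((k : ℝ)⁻¹ : ℂ) • z)ᴴ * (((k : ℝ)⁻¹ : ℂ) • z) =
      ((((k : ℝ)⁻¹) ^ 2 : ℝ) : ℂ) • (zᴴ * z) := by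
    intro z
    simp [conjTranspose_smul, smul_smul, sq]
  simp only [Function.comp_apply, hs, krausMap_smul, det_smul, ← Complex.ofReal_pow,
    Complex.re_ofReal_mul]
  exact mul_le_mul_of_nonneg_left h (by positivity)

end IntegralKrausMap

theorem stmt0 (m n : ℕ) (hm : 0 < m) (hn : 0 < n)
    (a : Fin n → Matrix (Fin m) (Fin m) ℤ)
    (η : Matrix (Fin m) (Fin m) ℂ → Matrix (Fin m) (Fin m) ℂ)
    (hη : ∀ b, η b = ∑ i, ((a i).map (Int.cast : ℤ → ℂ)) * b
        * ((a i).map (Int.cast : ℤ → ℂ))ᴴ)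
    (hrank : ∀ b : Matrix (Fin m) (Fin m) ℂ, b.PosSemidef → b.rank ≤ (η b).rank) :
    (∀ b : Matrix (Fin m) (Fin m) ℂ, b.PosDef → b.det = 1 → (1 : ℂ) ≤ (η b).det)
      ∧ 1 ≤ cap η := by
  obtain rfl : η = krausMap a := funext hη
  have key : ∀ b : Matrix (Fin m) (Fin m) ℂ, b.PosDef → b.det = 1 →
      (1 : ℂ) ≤ (krausMap a b).det := by
    intro b hb hdet
    have him := (Complex.le_def.1 (posSemidef_krausMap a hb.posSemidef).det_nonneg).2
    open scoped MatrixOrder Matrix.Norms.L2Operator in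
    obtain ⟨y, -, rfl⟩ := CStarAlgebra.isStrictlyPositive_iff_eq_star_mul_self.mp
      hb.isStrictlyPositive
    have h := det_re_le_krausMap a hrank y
    rw [← star_eq_conjTranspose, hdet] at h
    exact Complex.le_def.2 ⟨h, him⟩
  refine ⟨key, le_csInf ⟨_, 1, .one, det_one, rfl⟩ ?_⟩
  rintro _ ⟨b, hb, hdet, rfl⟩
  exact (Complex.le_def.1 (key b hb hdet)).1
end

section
/- A positive linear map η : Mₘ(ℂ) → Mₘ(ℂ) is rank non-decreasing if and only if cap(η) > 0. -/
open ComplexOrder Matrix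

section HermitianForms

variable {n : Type*} [Fintype n]

/-- The span of the columns of the unitary matrix `U` indexed by `T`, described by the vanishing
of the other coordinates. -/
def coordSubspace (U : Matrix n n ℂ) (T : Finset n) : Submodule ℂ (n → ℂ) :=
  LinearMap.ker ((LinearMap.funLeft ℂ ℂ ((↑) : {j // j ∉ T} → n)) ∘ₗ Uᴴ.mulVecLin)

lemma mem_coordSubspace {U : Matrix n n ℂ} {T : Finset n} {x : n → ℂ} :
    x ∈ coordSubspace U T ↔ ∀ j ∉ T, (Uᴴ *ᵥ x) j = 0 := by
  simp [coordSubspace, funext_iff, LinearMap.funLeft_apply]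

/-- The form `x ↦ re (xᴴ A x)` is at least `δ ‖x‖²` on some subspace of dimension at least `k`. -/
def BoundedBelowOnDim (A : Matrix n n ℂ) (k : ℕ) (δ : ℝ) : Prop :=
  ∃ W : Submodule ℂ (n → ℂ), k ≤ Module.finrank ℂ W ∧
    ∀ x ∈ W, δ * ∑ j, ‖x j‖ ^ 2 ≤ (star x ⬝ᵥ A *ᵥ x).re

lemma BoundedBelowOnDim.anti {A : Matrix n n ℂ} {k : ℕ} {δ δ' : ℝ}
    (h : BoundedBelowOnDim A k δ) (hδ : δ' ≤ δ) : BoundedBelowOnDim A k δ' := by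
  obtain ⟨W, hk, hW⟩ := h
  exact ⟨W, hk, fun x hx => le_trans (by gcongr) (hW x hx)⟩

lemma norm_dotProduct_mulVec_le (E : Matrix n n ℂ) {ε : ℝ} (hε : 0 ≤ ε)
    (hE : ∀ i j, ‖E i j‖ ≤ ε) (x : n → ℂ) :
    ‖star x ⬝ᵥ E *ᵥ x‖ ≤ ε * Fintype.card n * ∑ j, ‖x j‖ ^ 2 := by
  calc ‖star x ⬝ᵥ E *ᵥ x‖ ≤ ∑ i, ∑ j, ‖x i‖ * (ε * ‖x j‖) := by
        simp only [dotProduct, mulVec, Finset.mul_sum]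
        refine (norm_sum_le _ _).trans (Finset.sum_le_sum fun i _ => ?_)
        refine (norm_sum_le _ _).trans (Finset.sum_le_sum fun j _ => ?_)
        rw [norm_mul, norm_mul, Pi.star_apply, norm_star]
        gcongr
        exact hE i j
    _ = ε * (∑ j, ‖x j‖) ^ 2 := by
        rw [sq, Finset.sum_mul_sum, Finset.mul_sum]
        refine Finset.sum_congr rfl fun i _ => ?_
        rw [Finset.mul_sum]
        exact Finset.sum_congr rfl fun j _ => by ring
    _ ≤ ε * (Fintype.card n * ∑ j, ‖x j‖ ^ 2) := by
        gcongr
        simpa using sq_sum_le_card_mul_sum_sq (s := (Finset.univ : Finset n)) (f := fun j => ‖x j‖)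
    _ = _ := by ring

lemma Finset.exists_pos_forall_le {ι : Type*} (s : Finset ι) (f : ι → ℝ)
    (hf : ∀ i ∈ s, 0 < f i) : ∃ ε > 0, ∀ i ∈ s, ε ≤ f i := by
  rcases s.eq_empty_or_nonempty with rfl | hs
  · exact ⟨1, one_pos, by simp⟩
  · obtain ⟨i, hi, h⟩ := s.exists_min_image f hs
    exact ⟨f i, hf i hi, h⟩

variable [DecidableEq n]

lemma Matrix.IsHermitian.eq_mul_diagonal_mul_conjTranspose {A : Matrix n n ℂ}
    (hA : A.IsHermitian) :
    A = (hA.eigenvectorUnitary : Matrix n n ℂ) * diagonal (fun i => (hA.eigenvalues i : ℂ)) *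
      (hA.eigenvectorUnitary : Matrix n n ℂ)ᴴ := by
  conv_lhs => rw [hA.spectral_theorem, Unitary.conjStarAlgAut_apply]
  rfl

lemma re_dotProduct_mul_diagonal_mul (U : Matrix n n ℂ) (d : n → ℝ) (x : n → ℂ) :
    (star x ⬝ᵥ (U * diagonal (fun i => (d i : ℂ)) * Uᴴ) *ᵥ x).re =
      ∑ j, d j * ‖(Uᴴ *ᵥ x) j‖ ^ 2 := by
  rw [← mulVec_mulVec, ← mulVec_mulVec, dotProduct_mulVec,
    show star x ᵥ* U = star (Uᴴ *ᵥ x) by rw [star_mulVec, conjTranspose_conjTranspose]]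
  simp only [dotProduct, mulVec_diagonal, Complex.re_sum, Pi.star_apply]
  refine Finset.sum_congr rfl fun j _ => ?_
  rw [mul_left_comm, Complex.star_def, Complex.conj_mul']
  norm_cast

lemma sum_norm_sq_conjTranspose_mulVec {U : Matrix n n ℂ} (hU : U ∈ unitaryGroup n ℂ)
    (x : n → ℂ) : ∑ j, ‖(Uᴴ *ᵥ x) j‖ ^ 2 = ∑ j, ‖x j‖ ^ 2 := by
  have h := re_dotProduct_mul_diagonal_mul U (fun _ => 1) x
  have h' := re_dotProduct_mul_diagonal_mul (1 : Matrix n n ℂ) (fun _ => 1) x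
  have hU' : U * Uᴴ = 1 := mem_unitaryGroup_iff.mp hU
  simp only [Complex.ofReal_one, diagonal_one, mul_one, one_mul, hU', conjTranspose_one,
    one_mulVec] at h h'
  exact h.symm.trans h'

lemma card_le_finrank_coordSubspace (U : Matrix n n ℂ) (T : Finset n) :
    T.card ≤ Module.finrank ℂ (coordSubspace U T) := by
  have h := LinearMap.finrank_range_add_finrank_ker
    ((LinearMap.funLeft ℂ ℂ ((↑) : {j // j ∉ T} → n)) ∘ₗ Uᴴ.mulVecLin)
  have h1 := Submodule.finrank_le (LinearMap.range
    ((LinearMap.funLeft ℂ ℂ ((↑) : {j // j ∉ T} → n)) ∘ₗ Uᴴ.mulVecLin))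
  have h2 : Fintype.card {j // j ∉ T} = Fintype.card n - T.card := by
    rw [Fintype.card_subtype_compl, Fintype.card_coe]
  have h3 := T.card_le_univ
  rw [Module.finrank_fintype_fun_eq_card] at h h1
  unfold coordSubspace
  omega

/-- A Courant–Fischer type bound. -/
lemma BoundedBelowOnDim.le_card_eigenvalues {A : Matrix n n ℂ} (hA : A.IsHermitian) {k : ℕ}
    {δ : ℝ} (h : BoundedBelowOnDim A k δ) :
    k ≤ (Finset.univ.filter fun j => δ ≤ hA.eigenvalues j).card := by
  obtain ⟨W, hk, hW⟩ := h
  set U : Matrix n n ℂ := ↑hA.eigenvectorUnitary with hUdef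
  set T := Finset.univ.filter fun j => hA.eigenvalues j < δ with hT
  have hdisj : Disjoint W (coordSubspace U T) := by
    rw [Submodule.disjoint_def]
    intro x hxW hxT
    rw [mem_coordSubspace] at hxT
    have h1 := hW x hxW
    rw [hA.eq_mul_diagonal_mul_conjTranspose, re_dotProduct_mul_diagonal_mul,
      ← sum_norm_sq_conjTranspose_mulVec hA.eigenvectorUnitary.2, ← sub_nonneg, Finset.mul_sum,
      ← Finset.sum_sub_distrib] at h1
    have hterm : ∀ j ∈ Finset.univ, hA.eigenvalues j * ‖(Uᴴ *ᵥ x) j‖ ^ 2 -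
        δ * ‖(Uᴴ *ᵥ x) j‖ ^ 2 ≤ 0 := by
      intro j _
      by_cases hj : j ∈ T
      · have : hA.eigenvalues j < δ := by simpa [hT] using hj
        nlinarith [sq_nonneg ‖(Uᴴ *ᵥ x) j‖]
      · simp [hxT j hj]
    have hzero := (Finset.sum_eq_zero_iff_of_nonpos hterm).1
      (le_antisymm (Finset.sum_nonpos hterm) h1)
    have hy : ∀ j, (Uᴴ *ᵥ x) j = 0 := by
      intro j
      by_cases hj : j ∈ T
      · have h2 : hA.eigenvalues j < δ := by simpa [hT] using hj
        have h3 := hzero j (Finset.mem_univ j)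
        rw [← sub_mul] at h3
        rcases mul_eq_zero.1 h3 with h4 | h4
        · linarith
        · simpa using h4
      · exact hxT j hj
    have hx : ∑ j, ‖x j‖ ^ 2 = 0 := by
      rw [← sum_norm_sq_conjTranspose_mulVec hA.eigenvectorUnitary.2]
      exact Finset.sum_eq_zero fun j _ => by rw [← hUdef, hy j]; simp
    funext j
    have := (Finset.sum_eq_zero_iff_of_nonneg fun j _ => sq_nonneg ‖x j‖).1 hx j
      (Finset.mem_univ j)
    simpa using this
  have h1 := Submodule.finrank_add_finrank_le_of_disjoint hdisj
  have h2 := card_le_finrank_coordSubspace U T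
  have h3 := Finset.card_filter_add_card_filter_not (s := (Finset.univ : Finset n))
    (fun j => δ ≤ hA.eigenvalues j)
  simp only [not_le, Finset.card_univ] at h3
  rw [Module.finrank_fintype_fun_eq_card] at h1
  rw [← hT] at h3
  omega

lemma Matrix.PosSemidef.eventually_boundedBelowOnDim {A : Matrix n n ℂ} (hA : A.PosSemidef)
    {k : ℕ} (hk : k ≤ A.rank) : ∃ δ > 0, ∀ᶠ B in nhds A, BoundedBelowOnDim B k δ := by
  set U : Matrix n n ℂ := ↑hA.1.eigenvectorUnitary with hUdef
  set T := Finset.univ.filter fun j => hA.1.eigenvalues j ≠ 0 with hT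
  obtain ⟨ε, hε, hεT⟩ := T.exists_pos_forall_le hA.1.eigenvalues fun j hj =>
    lt_of_le_of_ne (hA.eigenvalues_nonneg j) (Ne.symm (by simpa [hT] using hj))
  set c : ℝ := ↑(Fintype.card n)
  have hc : 0 ≤ c := Nat.cast_nonneg _
  have hpos : 0 < ε / (2 * (c + 1)) := by positivity
  refine ⟨ε / 2, by positivity, ?_⟩
  have hev : ∀ᶠ B in nhds A, ∀ i j, ‖(B - A) i j‖ < ε / (2 * (c + 1)) := by
    refine Filter.eventually_all.2 fun i => Filter.eventually_all.2 fun j => ?_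
    have hcont : Continuous fun B : Matrix n n ℂ => ‖(B - A) i j‖ :=
      (((continuous_id.sub continuous_const).matrix_elem i j)).norm
    exact hcont.continuousAt.eventually_lt continuousAt_const (by simpa using hpos)
  filter_upwards [hev] with B hB
  refine ⟨coordSubspace U T, ?_, fun x hx => ?_⟩
  · refine (hk.trans_eq ?_).trans (card_le_finrank_coordSubspace U T)
    rw [hA.1.rank_eq_card_non_zero_eigs, Fintype.card_subtype]
  · rw [mem_coordSubspace] at hx
    have h1 : ε * ∑ j, ‖x j‖ ^ 2 ≤ (star x ⬝ᵥ A *ᵥ x).re := by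
      rw [hA.1.eq_mul_diagonal_mul_conjTranspose, re_dotProduct_mul_diagonal_mul,
        ← sum_norm_sq_conjTranspose_mulVec hA.1.eigenvectorUnitary.2, Finset.mul_sum]
      refine Finset.sum_le_sum fun j _ => ?_
      by_cases hj : j ∈ T
      · gcongr
        exact hεT j hj
      · have h0 := hx j hj
        rw [hUdef] at h0
        simp [h0]
    have h2 := norm_dotProduct_mulVec_le (B - A) hpos.le (fun i j => (hB i j).le) x
    have h3 := (abs_le.1 ((Complex.abs_re_le_norm _).trans h2)).1
    rw [sub_mulVec, dotProduct_sub, Complex.sub_re] at h3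
    have h4 : ε / (2 * (c + 1)) * c ≤ ε / 2 := by
      rw [div_mul_eq_mul_div, div_le_div_iff₀ (by positivity) two_pos]
      nlinarith
    have h5 : 0 ≤ ∑ j, ‖x j‖ ^ 2 := by positivity
    nlinarith [mul_le_mul_of_nonneg_right h4 h5]

lemma isCompact_unitaryGroup : IsCompact (unitaryGroup n ℂ : Set (Matrix n n ℂ)) := by
  have hball : IsCompact (Set.pi Set.univ fun _ : n => Set.pi Set.univ fun _ : n =>
      Metric.closedBall (0 : ℂ) 1) :=
    isCompact_univ_pi fun _ => isCompact_univ_pi fun _ => isCompact_closedBall 0 1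
  refine hball.of_isClosed_subset ?_ fun U hU => ?_
  · have : (unitaryGroup n ℂ : Set (Matrix n n ℂ)) = {U | U * star U = 1} := by
      ext U; exact mem_unitaryGroup_iff
    rw [this]
    exact isClosed_eq (by fun_prop) continuous_const
  · exact fun i _ j _ => mem_closedBall_zero_iff.2 (entry_norm_bound_of_unitary hU i j)

/-- Counting form of eigenvalue domination implies domination of the products. -/
lemma prod_le_prod_of_card_le (a b : n → ℝ) (ha : ∀ i, 0 ≤ a i)
    (h : ∀ i, (Finset.univ.filter fun j => a i ≤ a j).card ≤
      (Finset.univ.filter fun j => a i ≤ b j).card) : ∏ i, a i ≤ ∏ i, b i := by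
  obtain ⟨f, hf, hfb⟩ := (Finset.all_card_le_biUnion_card_iff_exists_injective
    fun i => Finset.univ.filter fun j => a i ≤ b j).1 (by
      intro s
      rcases s.eq_empty_or_nonempty with rfl | hs
      · simp
      obtain ⟨i, hi, hmin⟩ := s.exists_min_image a hs
      calc s.card ≤ (Finset.univ.filter fun j => a i ≤ a j).card :=
            Finset.card_le_card fun j hj => by simpa using hmin j hj
        _ ≤ _ := h i
        _ ≤ _ := Finset.card_le_card
            (Finset.subset_biUnion_of_mem (fun i => Finset.univ.filter fun j => a i ≤ b j) hi))
  calc ∏ i, a i ≤ ∏ i, b (f i) :=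
        Finset.prod_le_prod (fun i _ => ha i) fun i _ => by simpa using hfb i
    _ = ∏ i, b i := Function.Bijective.prod_comp (Finite.injective_iff_bijective.1 hf) b

/-- The orthogonal projection (for unitary `U`) onto the span of the columns of `U` in `S`. -/
noncomputable def colProj (U : Matrix n n ℂ) (S : Finset n) : Matrix n n ℂ :=
  U * diagonal (fun i => ((if i ∈ S then 1 else 0 : ℝ) : ℂ)) * Uᴴ

lemma posSemidef_mul_diagonal_mul (U : Matrix n n ℂ) {d : n → ℝ} (hd : ∀ i, 0 ≤ d i) :
    (U * diagonal (fun i => (d i : ℂ)) * Uᴴ).PosSemidef :=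
  (PosSemidef.diagonal fun i => by simpa using hd i).mul_mul_conjTranspose_same U

lemma posSemidef_colProj (U : Matrix n n ℂ) (S : Finset n) : (colProj U S).PosSemidef :=
  posSemidef_mul_diagonal_mul U fun i => by split_ifs <;> simp

lemma rank_colProj {U : Matrix n n ℂ} (hU : U ∈ unitaryGroup n ℂ) (S : Finset n) :
    (colProj U S).rank = S.card := by
  have h1 : IsUnit U.det := UnitaryGroup.det_isUnit ⟨U, hU⟩
  have h2 : IsUnit Uᴴ.det := by rw [det_conjTranspose]; exact h1.star
  rw [colProj, rank_mul_eq_left_of_isUnit_det _ _ h2, rank_mul_eq_right_of_isUnit_det _ _ h1,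
    rank_diagonal, Fintype.card_subtype]
  congr 1
  ext i
  simp

lemma exists_boundedBelowOnDim_colProj (η : Matrix n n ℂ →ₗ[ℂ] Matrix n n ℂ)
    (hpos : ∀ b : Matrix n n ℂ, b.PosSemidef → (η b).PosSemidef)
    (hrank : ∀ b : Matrix n n ℂ, b.PosSemidef → b.rank ≤ (η b).rank) (S : Finset n) :
    ∃ δ > 0, ∀ U ∈ unitaryGroup n ℂ, BoundedBelowOnDim (η (colProj U S)) S.card δ := by
  have hcont : Continuous fun U : Matrix n n ℂ => η (colProj U S) := by
    have : Continuous η := LinearMap.continuous_of_finiteDimensional η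
    unfold colProj
    fun_prop
  refine isCompact_unitaryGroup.induction_on
    (p := fun s => ∃ δ > 0, ∀ U ∈ s, BoundedBelowOnDim (η (colProj U S)) S.card δ)
    ⟨1, one_pos, by simp⟩ ?_ ?_ ?_
  · rintro s t hst ⟨δ, hδ, h⟩
    exact ⟨δ, hδ, fun U hU => h U (hst hU)⟩
  · rintro s t ⟨δ, hδ, h⟩ ⟨δ', hδ', h'⟩
    refine ⟨min δ δ', lt_min hδ hδ', fun U hU => hU.elim (fun hU => ?_) fun hU => ?_⟩
    · exact (h U hU).anti (min_le_left _ _)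
    · exact (h' U hU).anti (min_le_right _ _)
  · intro U hU
    obtain ⟨δ, hδ, h⟩ := (hpos _ (posSemidef_colProj U S)).eventually_boundedBelowOnDim
      (k := S.card) ((rank_colProj hU S).symm.le.trans (hrank _ (posSemidef_colProj U S)))
    exact ⟨_, mem_nhdsWithin_of_mem_nhds (hcont.continuousAt.eventually h), δ, hδ,
      fun V hV => hV⟩

lemma exists_pos_mul_det_le_det (η : Matrix n n ℂ →ₗ[ℂ] Matrix n n ℂ)
    (hpos : ∀ b : Matrix n n ℂ, b.PosSemidef → (η b).PosSemidef)
    (hrank : ∀ b : Matrix n n ℂ, b.PosSemidef → b.rank ≤ (η b).rank) :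
    ∃ C > 0, ∀ b : Matrix n n ℂ, b.PosSemidef → C * b.det.re ≤ (η b).det.re := by
  choose δ hδ hbdd using exists_boundedBelowOnDim_colProj η hpos hrank
  obtain ⟨ε, hε, hεδ⟩ := Finset.univ.exists_pos_forall_le δ fun S _ => hδ S
  refine ⟨ε ^ Fintype.card n, by positivity, fun b hb => ?_⟩
  set l := hb.1.eigenvalues with hl
  have hl0 : ∀ i, 0 ≤ l i := hb.eigenvalues_nonneg
  have hηb := hpos b hb
  have hb' := hb.1.eq_mul_diagonal_mul_conjTranspose
  have hprod := prod_le_prod_of_card_le (fun i => ε * l i) hηb.1.eigenvalues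
    (fun i => mul_nonneg hε.le (hl0 i)) fun i => by
      simp only [mul_le_mul_iff_right₀ hε]
      set S := Finset.univ.filter fun j => l i ≤ l j with hS
      apply BoundedBelowOnDim.le_card_eigenvalues
      obtain ⟨W, hW, hWx⟩ := (hbdd S hb.1.eigenvectorUnitary hb.1.eigenvectorUnitary.2).anti
        (hεδ S (Finset.mem_univ S))
      refine ⟨W, hW, fun x hx => ?_⟩
      have hdiff : (b - (l i : ℂ) • colProj hb.1.eigenvectorUnitary S).PosSemidef := by
        have h := posSemidef_mul_diagonal_mul (hb.1.eigenvectorUnitary : Matrix n n ℂ)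
          (d := fun j => l j - l i * if j ∈ S then 1 else 0) fun j => by
            split_ifs with hj
            · have : l i ≤ l j := by simpa [hS] using hj
              simpa using this
            · simpa using hl0 j
        convert h using 1
        refine (congrArg (· - (l i : ℂ) • colProj hb.1.eigenvectorUnitary S) hb').trans ?_
        rw [colProj, ← smul_mul_assoc, ← mul_smul_comm, ← sub_mul, ← mul_sub, ← diagonal_smul,
          diagonal_sub]
        congr 3
        ext j
        by_cases hj : j ∈ S <;> simp [hl, hj]
      have h1 := (hpos _ hdiff).re_dotProduct_nonneg x
      rw [map_sub, map_smul, sub_mulVec, dotProduct_sub, smul_mulVec, dotProduct_smul] at h1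
      simp only [map_sub, RCLike.re_to_complex, smul_eq_mul, Complex.re_ofReal_mul] at h1
      have h2 := mul_le_mul_of_nonneg_left (hWx x hx) (hl0 i)
      linarith
  rw [hb.1.det_eq_prod_eigenvalues, hηb.1.det_eq_prod_eigenvalues]
  rw [Finset.prod_mul_distrib, Finset.prod_const, Finset.card_univ] at hprod
  have hre : ∀ f : n → ℝ, (∏ i, ((f i : ℝ) : ℂ)).re = ∏ i, f i := fun f => by
    rw [← Complex.ofReal_prod, Complex.ofReal_re]
  exact (congrArg₂ (· ≤ ·) (congrArg _ (hre l)) (hre _)).mpr hprod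

lemma prod_ite_eq_pow_sub_rank {A : Matrix n n ℂ} (hA : A.IsHermitian) (t : ℝ) :
    ∏ i, (if hA.eigenvalues i = 0 then t else 1) = t ^ (Fintype.card n - A.rank) := by
  rw [Finset.prod_ite, Finset.prod_const, Finset.prod_const_one, mul_one,
    hA.rank_eq_card_non_zero_eigs, ← Fintype.card_subtype_compl]
  simp [Fintype.card_subtype]

lemma Matrix.IsHermitian.exists_norm_det_add_smul_le {A : Matrix n n ℂ} (hA : A.IsHermitian)
    (B : Matrix n n ℂ) : ∃ C, ∀ t ∈ Set.Icc (0 : ℝ) 1,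
      ‖(A + (t : ℂ) • B).det‖ ≤ C * t ^ (Fintype.card n - A.rank) := by
  set U : Matrix n n ℂ := ↑hA.eigenvectorUnitary with hUdef
  have hUU' : U * Uᴴ = 1 := mem_unitaryGroup_iff.1 hA.eigenvectorUnitary.2
  set M : ℝ → Matrix n n ℂ := fun t => diagonal (fun i => (hA.eigenvalues i : ℂ)) +
    diagonal (fun i => if hA.eigenvalues i = 0 then (1 : ℂ) else t) * (Uᴴ * B * U) with hM
  have hMcont : Continuous fun t => (M t).det := by
    refine Continuous.matrix_det (continuous_const.add (Continuous.matrix_mul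
      (Continuous.matrix_diagonal (continuous_pi fun i => ?_)) continuous_const))
    split_ifs <;> fun_prop
  obtain ⟨C, hC⟩ := isCompact_Icc.exists_bound_of_continuousOn
    (s := Set.Icc (0 : ℝ) 1) hMcont.continuousOn
  refine ⟨C, fun t ht => ?_⟩
  have hfac : A + (t : ℂ) • B =
      U * (diagonal (fun i => ((if hA.eigenvalues i = 0 then t else 1 : ℝ) : ℂ)) * M t) * Uᴴ := by
    have h1 : diagonal (fun i => ((if hA.eigenvalues i = 0 then t else 1 : ℝ) : ℂ)) * M t =
        diagonal (fun i => (hA.eigenvalues i : ℂ)) + (t : ℂ) • (Uᴴ * B * U) := by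
      rw [hM, mul_add, ← mul_assoc, diagonal_mul_diagonal, diagonal_mul_diagonal]
      ext i j
      by_cases hi : hA.eigenvalues i = 0 <;> simp [hi, diagonal_apply]
    rw [h1, mul_add, add_mul, ← hA.eq_mul_diagonal_mul_conjTranspose, mul_smul_comm,
      smul_mul_assoc]
    congr 2
    rw [mul_assoc, mul_assoc, hUU', mul_one, ← mul_assoc, hUU', one_mul]
  have hdetU : U.det * Uᴴ.det = 1 := by rw [← det_mul, hUU', det_one]
  rw [hfac, det_mul, det_mul, mul_right_comm, hdetU, one_mul, det_mul, det_diagonal,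
    ← Complex.ofReal_prod, prod_ite_eq_pow_sub_rank, norm_mul, Complex.norm_real,
    Real.norm_of_nonneg (pow_nonneg ht.1 _), mul_comm]
  exact mul_le_mul_of_nonneg_right (hC t ht) (pow_nonneg ht.1 _)

lemma Matrix.PosSemidef.exists_pos_le_det_add_smul_one {A : Matrix n n ℂ} (hA : A.PosSemidef) :
    ∃ c > 0, ∀ t : ℝ, 0 < t →
      c * t ^ (Fintype.card n - A.rank) ≤ (A + (t : ℂ) • (1 : Matrix n n ℂ)).det.re := by
  set l := hA.1.eigenvalues with hl
  have hl0 : ∀ i, 0 ≤ l i := hA.eigenvalues_nonneg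
  set U : Matrix n n ℂ := ↑hA.1.eigenvectorUnitary with hUdef
  have hUU' : U * Uᴴ = 1 := mem_unitaryGroup_iff.1 hA.1.eigenvectorUnitary.2
  refine ⟨∏ i, if l i = 0 then 1 else l i, Finset.prod_pos fun i _ => ?_, fun t ht => ?_⟩
  · split_ifs with h
    · exact one_pos
    · exact (hl0 i).lt_of_ne' h
  have hfac : A + (t : ℂ) • (1 : Matrix n n ℂ) =
      U * diagonal (fun i => ((l i + t : ℝ) : ℂ)) * Uᴴ := by
    have h1 : diagonal (fun i => ((l i + t : ℝ) : ℂ)) =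
        diagonal (fun i => (l i : ℂ)) + (t : ℂ) • (1 : Matrix n n ℂ) := by
      ext i j
      by_cases hij : i = j <;> simp [hij]
    rw [h1, mul_add, add_mul, ← hA.1.eq_mul_diagonal_mul_conjTranspose, mul_smul_comm,
      smul_mul_assoc, mul_one, hUU']
  have hdetU : U.det * Uᴴ.det = 1 := by rw [← det_mul, hUU', det_one]
  rw [hfac, det_mul, det_mul, mul_right_comm, hdetU, one_mul, det_diagonal,
    ← Complex.ofReal_prod, Complex.ofReal_re, ← prod_ite_eq_pow_sub_rank hA.1,
    ← Finset.prod_mul_distrib]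
  refine Finset.prod_le_prod (fun i _ => ?_) fun i _ => ?_
  · rw [← hl]
    have := hl0 i
    split_ifs <;> simp [ht.le, this]
  · rw [← hl]
    split_ifs with h
    · simp [h]
    · simp [ht.le]

end HermitianForms

section Capacity

variable {m : ℕ} (η : Matrix (Fin m) (Fin m) ℂ →ₗ[ℂ] Matrix (Fin m) (Fin m) ℂ)

lemma le_cap {C : ℝ}
    (h : ∀ b : Matrix (Fin m) (Fin m) ℂ, b.PosDef → b.det = 1 → C ≤ (η b).det.re) :
    C ≤ cap η := by
  refine le_csInf ⟨_, 1, PosDef.one, det_one, rfl⟩ ?_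
  rintro x ⟨b, hb, hdet, rfl⟩
  exact h b hb hdet

lemma cap_le_det
    (hpos : ∀ b : Matrix (Fin m) (Fin m) ℂ, b.PosSemidef → (η b).PosSemidef)
    {b : Matrix (Fin m) (Fin m) ℂ} (hb : b.PosDef) (hdet : b.det = 1) :
    cap η ≤ (η b).det.re := by
  refine csInf_le ⟨0, ?_⟩ ⟨b, hb, hdet, rfl⟩
  rintro x ⟨c, hc, -, rfl⟩
  exact (Complex.le_def.1 (hpos c hc.posSemidef).det_nonneg).1

lemma cap_mul_det_le
    (hpos : ∀ b : Matrix (Fin m) (Fin m) ℂ, b.PosSemidef → (η b).PosSemidef)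
    (hm : m ≠ 0) {b : Matrix (Fin m) (Fin m) ℂ} (hb : b.PosDef) :
    cap η * b.det.re ≤ (η b).det.re := by
  have hdpos := hb.det_pos
  set d := b.det.re with hd
  have hd0 : 0 < d := (Complex.lt_def.1 hdpos).1
  have hdd : b.det = (d : ℂ) :=
    Complex.ext rfl (by simpa using (Complex.lt_def.1 hdpos).2.symm)
  set c : ℝ := (d⁻¹) ^ ((m : ℝ)⁻¹) with hc
  have hc0 : 0 < c := Real.rpow_pos_of_pos (inv_pos.2 hd0) _
  have hcm : c ^ m = d⁻¹ := Real.rpow_inv_natCast_pow (inv_pos.2 hd0).le hm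
  have h := cap_le_det η hpos (b := (c : ℂ) • b)
    (hb.smul (by simpa using hc0)) (by
      rw [det_smul, Fintype.card_fin, hdd, ← Complex.ofReal_pow, hcm, ← Complex.ofReal_mul,
        inv_mul_cancel₀ hd0.ne', Complex.ofReal_one])
  rw [map_smul, det_smul, Fintype.card_fin, ← Complex.ofReal_pow, hcm, Complex.re_ofReal_mul,
    inv_mul_eq_div, le_div_iff₀ hd0] at h
  exact h

end Capacity

theorem stmt1 (m : ℕ)
    (η : Matrix (Fin m) (Fin m) ℂ →ₗ[ℂ] Matrix (Fin m) (Fin m) ℂ)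
    (hpos : ∀ b : Matrix (Fin m) (Fin m) ℂ, b.PosSemidef → (η b).PosSemidef) :
    (∀ b : Matrix (Fin m) (Fin m) ℂ, b.PosSemidef → b.rank ≤ (η b).rank)
      ↔ 0 < cap (⇑η) := by
  constructor
  · intro hrank
    obtain ⟨C, hC, h⟩ := exists_pos_mul_det_le_det η hpos hrank
    refine hC.trans_le (le_cap η fun b hb hdet => ?_)
    simpa [hdet] using h b hb.posSemidef
  · intro hcap b hb
    rcases eq_or_ne m 0 with rfl | hm
    · exact (rank_le_width b).trans (Nat.zero_le _)
    by_contra! hlt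
    obtain ⟨C, hC⟩ := (hpos b hb).1.exists_norm_det_add_smul_le (η 1)
    obtain ⟨c, hc, hlow⟩ := hb.exists_pos_le_det_add_smul_one
    rw [Fintype.card_fin] at hC hlow
    have hbm := rank_le_width b
    obtain ⟨k, hk⟩ : ∃ k, m - (η b).rank = (m - b.rank) + (k + 1) :=
      ⟨b.rank - (η b).rank - 1, by omega⟩
    have key : ∀ t ∈ Set.Ioc (0 : ℝ) 1, cap η * c ≤ C * t ^ (k + 1) := by
      intro t ht
      have hdef : (b + (t : ℂ) • (1 : Matrix (Fin m) (Fin m) ℂ)).PosDef :=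
        PosDef.posSemidef_add hb (PosDef.one.smul (by simpa using ht.1))
      have h1 := cap_mul_det_le η hpos hm hdef
      rw [map_add, map_smul] at h1
      have h2 := (Complex.re_le_norm _).trans (hC t ⟨ht.1.le, ht.2⟩)
      have h3 := mul_le_mul_of_nonneg_left (hlow t ht.1) hcap.le
      rw [hk, pow_add, mul_left_comm] at h2
      have h4 : 0 < t ^ (m - b.rank) := pow_pos ht.1 _
      refine le_of_mul_le_mul_left ?_ h4
      linarith
    have hlim : Filter.Tendsto (fun t : ℝ => C * t ^ (k + 1)) (nhdsWithin 0 (Set.Ioi 0))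
        (nhds 0) := by
      have : Continuous fun t : ℝ => C * t ^ (k + 1) := by fun_prop
      simpa using (this.tendsto 0).mono_left nhdsWithin_le_nhds
    have hle : cap η * c ≤ 0 := ge_of_tendsto hlim
      (Filter.mem_of_superset (Ioc_mem_nhdsGT one_pos) key)
    exact absurd (mul_pos hcap hc) hle.not_gt
end

section
/- Let η₀, η₁ : Mₘ(ℂ) → Mₘ(ℂ) be positive linear maps such that η₁ − η₀ is also a positive linear map (written η₁ ≥ η₀). Then cap(η₁)^{1/m} ≥ cap(η₁ − η₀)^{1/m} + cap(η₀)^{1/m}. -/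
open ComplexOrder Matrix

/-- The arithmetic-geometric mean inequality for the eigenvalues of a positive semidefinite
matrix. -/
theorem Matrix.PosSemidef.rpow_det_le_trace_div {m : ℕ} (hm : 0 < m)
    {A : Matrix (Fin m) (Fin m) ℂ} (hA : A.PosSemidef) :
    A.det.re ^ ((1 : ℝ) / m) ≤ A.trace.re / m := by
  have amgm := Real.geom_mean_le_arith_mean Finset.univ (fun _ : Fin m => (1 : ℝ))
    hA.isHermitian.eigenvalues (fun _ _ => zero_le_one) (by simpa using hm)
    (fun i _ => hA.eigenvalues_nonneg i)
  rw [hA.isHermitian.det_eq_prod_eigenvalues, hA.isHermitian.trace_eq_sum_eigenvalues]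
  rw [← RCLike.ofReal_prod, ← RCLike.ofReal_sum, RCLike.ofReal_eq_complex_ofReal,
    Complex.ofReal_re, Complex.ofReal_re]
  simpa using amgm

open scoped MatrixOrder in
/-- The Minkowski determinant inequality. -/
theorem Matrix.PosSemidef.rpow_det_add_rpow_det_le {m : ℕ} (hm : 0 < m)
    {A B : Matrix (Fin m) (Fin m) ℂ} (hA : A.PosSemidef) (hB : B.PosSemidef) :
    A.det.re ^ ((1 : ℝ) / m) + B.det.re ^ ((1 : ℝ) / m) ≤ (A + B).det.re ^ ((1 : ℝ) / m) := by
  have hm' : (0 : ℝ) < m := by exact_mod_cast hm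
  have hAB := hA.add hB
  by_cases hdet : IsUnit (A + B).det
  · obtain ⟨S, hS : A + B = Sᴴ * S⟩ := CStarAlgebra.nonneg_iff_eq_star_mul_self.mp hAB.nonneg
    have hSu : IsUnit S.det := by
      rw [hS, det_mul] at hdet
      exact isUnit_of_mul_isUnit_right hdet
    have key : ∀ X : Matrix (Fin m) (Fin m) ℂ, X.PosSemidef →
        X.det.re ^ ((1 : ℝ) / m) ≤
          (A + B).det.re ^ ((1 : ℝ) / m) * ((S⁻¹ᴴ * X * S⁻¹).trace.re / m) := by
      intro X hX
      have hY : (S⁻¹ᴴ * X * S⁻¹).PosSemidef := hX.conjTranspose_mul_mul_same _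
      have hXY : X = Sᴴ * (S⁻¹ᴴ * X * S⁻¹) * S := by
        have h1 : Sᴴ * S⁻¹ᴴ = 1 := by
          rw [← conjTranspose_mul, nonsing_inv_mul _ hSu, conjTranspose_one]
        calc X = (Sᴴ * S⁻¹ᴴ) * X * (S⁻¹ * S) := by
              rw [h1, nonsing_inv_mul _ hSu, one_mul, mul_one]
          _ = _ := by simp only [mul_assoc]
      have hdX : X.det = (A + B).det * (S⁻¹ᴴ * X * S⁻¹).det := by
        conv_lhs => rw [hXY]
        rw [hS, det_mul, det_mul, det_mul Sᴴ S]
        ring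
      have him : (A + B).det.im = 0 := (Complex.nonneg_iff.mp hAB.det_nonneg).2.symm
      have hre : X.det.re = (A + B).det.re * (S⁻¹ᴴ * X * S⁻¹).det.re := by
        rw [hdX, Complex.mul_re, him, zero_mul, sub_zero]
      have hn := (Complex.nonneg_iff.mp hAB.det_nonneg).1
      rw [hre, Real.mul_rpow hn (Complex.nonneg_iff.mp hY.det_nonneg).1]
      exact mul_le_mul_of_nonneg_left (hY.rpow_det_le_trace_div hm) (Real.rpow_nonneg hn _)
    have htr : (S⁻¹ᴴ * A * S⁻¹).trace.re / m + (S⁻¹ᴴ * B * S⁻¹).trace.re / m = 1 := by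
      have h1 : S⁻¹ᴴ * A * S⁻¹ + S⁻¹ᴴ * B * S⁻¹ = 1 := by
        rw [← add_mul, ← mul_add, hS, mul_assoc, mul_assoc, mul_nonsing_inv _ hSu, mul_one,
          ← conjTranspose_mul, mul_nonsing_inv _ hSu, conjTranspose_one]
      rw [← add_div, ← Complex.add_re, ← trace_add, h1]
      simp [hm'.ne']
    calc _ ≤ _ := add_le_add (key A hA) (key B hB)
      _ = _ := by rw [← mul_add, htr, mul_one]
  · have hz : ∀ X Y : Matrix (Fin m) (Fin m) ℂ, X.PosSemidef → Y.PosSemidef →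
        ¬ IsUnit (X + Y).det → X.det = 0 := by
      intro X Y hX hY h
      by_contra hne
      have hXd : X.PosDef :=
        hX.posDef_iff_det_ne_zero.mpr hne
      exact h (hXd.add_posSemidef hY).det_pos.ne'.isUnit
    have hne : (1 : ℝ) / m ≠ 0 := by positivity
    rw [hz A B hA hB hdet, hz B A hB hA (by rwa [add_comm]), Complex.zero_re,
      Real.zero_rpow hne, add_zero]
    exact Real.rpow_nonneg (Complex.nonneg_iff.mp hAB.det_nonneg).1 _

theorem cap_nonneg {m : ℕ} {η : Matrix (Fin m) (Fin m) ℂ → Matrix (Fin m) (Fin m) ℂ}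
    (hη : ∀ b : Matrix (Fin m) (Fin m) ℂ, b.PosSemidef → (η b).PosSemidef) : 0 ≤ cap η := by
  refine Real.sInf_nonneg ?_
  rintro _ ⟨b, hb, -, rfl⟩
  exact (Complex.nonneg_iff.mp (hη b hb.posSemidef).det_nonneg).1

theorem cap_le_re_det {m : ℕ} {η : Matrix (Fin m) (Fin m) ℂ → Matrix (Fin m) (Fin m) ℂ}
    (hη : ∀ b : Matrix (Fin m) (Fin m) ℂ, b.PosSemidef → (η b).PosSemidef)
    {b : Matrix (Fin m) (Fin m) ℂ} (hb : b.PosDef) (hdet : b.det = 1) :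
    cap η ≤ (η b).det.re := by
  refine csInf_le ⟨0, ?_⟩ ⟨b, hb, hdet, rfl⟩
  rintro _ ⟨c, hc, -, rfl⟩
  exact (Complex.nonneg_iff.mp (hη c hc.posSemidef).det_nonneg).1

theorem stmt2 (m : ℕ) (hm : 0 < m)
    (η₀ η₁ : Matrix (Fin m) (Fin m) ℂ →ₗ[ℂ] Matrix (Fin m) (Fin m) ℂ)
    (hpos₀ : ∀ b : Matrix (Fin m) (Fin m) ℂ, b.PosSemidef → (η₀ b).PosSemidef)
    (hpos₁ : ∀ b : Matrix (Fin m) (Fin m) ℂ, b.PosSemidef → (η₁ b).PosSemidef)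
    (hpos : ∀ b : Matrix (Fin m) (Fin m) ℂ, b.PosSemidef → ((η₁ - η₀) b).PosSemidef) :
    cap (⇑(η₁ - η₀)) ^ ((1 : ℝ) / m) + cap (⇑η₀) ^ ((1 : ℝ) / m)
      ≤ cap (⇑η₁) ^ ((1 : ℝ) / m) := by
  have hm' : (0 : ℝ) < m := by exact_mod_cast hm
  have hsum : 0 ≤ cap (⇑(η₁ - η₀)) ^ ((1 : ℝ) / m) + cap (⇑η₀) ^ ((1 : ℝ) / m) :=
    add_nonneg (Real.rpow_nonneg (cap_nonneg hpos) _) (Real.rpow_nonneg (cap_nonneg hpos₀) _)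
  rw [one_div, Real.le_rpow_inv_iff_of_pos (by simpa using hsum) (cap_nonneg hpos₁) hm',
    ← one_div]
  refine le_csInf ⟨_, 1, PosDef.one, det_one, rfl⟩ ?_
  rintro _ ⟨b, hb, hdet, rfl⟩
  have hn := (Complex.nonneg_iff.mp (hpos₁ b hb.posSemidef).det_nonneg).1
  rw [← Real.le_rpow_inv_iff_of_pos hsum hn hm', ← one_div]
  have hmink := (hpos b hb.posSemidef).rpow_det_add_rpow_det_le hm (hpos₀ b hb.posSemidef)
  rw [LinearMap.sub_apply, sub_add_cancel] at hmink
  refine le_trans (add_le_add ?_ ?_) hmink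
  · exact Real.rpow_le_rpow (cap_nonneg hpos) (cap_le_re_det hpos hb hdet) (by positivity)
  · exact Real.rpow_le_rpow (cap_nonneg hpos₀) (cap_le_re_det hpos₀ hb hdet) (by positivity)
end

section
/- Let η : Mₘ(ℂ) → Mₘ(ℂ) be an indecomposable positive linear map and let c ∈ Mₘ(ℂ) be a positive definite matrix with det(c) = 1 and det(η(c)) = cap(η). Then the operator scaling η_{η(c)^{-1/2}, c^{1/2}}, i.e., the map b ↦ η(c)^{-1/2} η(c^{1/2} b c^{1/2}) η(c)^{-1/2}, is doubly stochastic: it maps 1ₘ to 1ₘ and its dual with respect to the inner product ⟨x,y⟩ = trₘ(x y*) maps 1ₘ to 1ₘ (equivalently, it is unital and trace-preserving). -/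
open ComplexOrder Matrix

/-- First-order comparison of determinants at the identity. -/
theorem trace_re_le_of_det_one_add_smul_re_le {n : Type*} [Fintype n] [DecidableEq n]
    (M N : Matrix n n ℂ)
    (h : ∀ t : ℝ, 0 < t → (1 + (t : ℂ) • N).det.re ≤ (1 + (t : ℂ) • M).det.re) :
    N.trace.re ≤ M.trace.re := by
  set p := (det (1 + (Polynomial.X : Polynomial ℂ) • M.map Polynomial.C)).divX.divX with hp
  set q := (det (1 + (Polynomial.X : Polynomial ℂ) • N.map Polynomial.C)).divX.divX with hq
  have hle : ∀ t : ℝ, 0 < t →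
      (N.trace + q.eval (t : ℂ) * t).re ≤ (M.trace + p.eval (t : ℂ) * t).re := by
    intro t ht
    have key := h t ht
    rw [Matrix.det_one_add_smul (t : ℂ) N, Matrix.det_one_add_smul (t : ℂ) M, ← hp, ← hq] at key
    have e : ∀ a b : ℂ, (1 + a * (t : ℂ) + b * (t : ℂ) ^ 2).re = 1 + (a + b * t).re * t := by
      intro a b
      rw [show 1 + a * (t : ℂ) + b * (t : ℂ) ^ 2 = 1 + (a + b * t) * t by ring]
      rw [Complex.add_re, Complex.re_mul_ofReal, Complex.one_re]
    rw [e, e] at key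
    exact le_of_mul_le_mul_right (by linarith) ht
  have lim : ∀ (a : ℂ) (g : Polynomial ℂ), Filter.Tendsto
      (fun t : ℝ => (a + g.eval (t : ℂ) * t).re) (nhdsWithin 0 (Set.Ioi 0)) (nhds a.re) := by
    intro a g
    have hcont : Continuous fun t : ℝ => (a + g.eval (t : ℂ) * t).re := by fun_prop
    simpa using (hcont.tendsto 0).mono_left nhdsWithin_le_nhds
  exact le_of_tendsto_of_tendsto (lim _ q) (lim _ p)
    (Filter.eventually_of_mem self_mem_nhdsWithin hle)

/-- A linear functional that is nonnegative on positive semidefinite matrices and vanishes at the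
identity is zero. -/
theorem eq_zero_of_nonneg_of_map_one_eq_zero {n : Type*} [Fintype n] [DecidableEq n]
    (L : Matrix n n ℂ →ₗ[ℂ] ℂ) (hL : ∀ P : Matrix n n ℂ, P.PosSemidef → 0 ≤ L P)
    (h1 : L 1 = 0) (b : Matrix n n ℂ) : L b = 0 := by
  open scoped MatrixOrder Matrix.Norms.L2Operator in
  have hb : b ∈ Submodule.span ℂ {a : Matrix n n ℂ | 0 ≤ a} := by
    rw [CStarAlgebra.span_nonneg]
    exact Submodule.mem_top
  induction hb using Submodule.span_induction with
  | mem P hP =>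
    have hle : P ≤ algebraMap ℝ (Matrix n n ℂ) ‖P‖ :=
      IsSelfAdjoint.le_algebraMap_norm_self (IsSelfAdjoint.of_nonneg hP)
    rw [Matrix.le_iff] at hle
    have h2 := hL _ hle
    rw [map_sub, IsScalarTower.algebraMap_apply ℝ ℂ (Matrix n n ℂ), Algebra.algebraMap_eq_smul_one,
      map_smul, h1, smul_zero, zero_sub, neg_nonneg] at h2
    exact le_antisymm h2 (hL P (Matrix.nonneg_iff_posSemidef.mp hP))
  | zero => exact map_zero L
  | add x y _ _ hx hy => rw [map_add, hx, hy, add_zero]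
  | smul a x _ hx => rw [map_smul, hx, smul_zero]

/-- By homogeneity, a lower bound for `det (η b)` over `det b = 1` extends to all positive
definite `b`. -/
theorem det_re_mul_le_of_cap {m : ℕ}
    (η : Matrix (Fin m) (Fin m) ℂ →ₗ[ℂ] Matrix (Fin m) (Fin m) ℂ)
    (hpos : ∀ b : Matrix (Fin m) (Fin m) ℂ, b.PosSemidef → (η b).PosSemidef)
    (hm : m ≠ 0) (b : Matrix (Fin m) (Fin m) ℂ) (hb : b.PosDef) :
    cap (⇑η) * b.det.re ≤ (η b).det.re := by
  obtain ⟨hd, hdi⟩ := Complex.pos_iff.mp hb.det_pos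
  set d := b.det.re with hd_def
  have hdet : b.det = (d : ℂ) := Complex.ext rfl (by simpa using hdi.symm)
  set l : ℝ := d⁻¹ ^ ((m : ℝ)⁻¹) with hl_def
  have hl : 0 < l := Real.rpow_pos_of_pos (inv_pos.mpr hd) _
  have hlm : l ^ m = d⁻¹ := Real.rpow_inv_natCast_pow (inv_pos.mpr hd).le hm
  have hbdd : BddBelow { x : ℝ | ∃ b : Matrix (Fin m) (Fin m) ℂ,
      b.PosDef ∧ b.det = 1 ∧ ((η b).det).re = x } := by
    refine ⟨0, ?_⟩
    rintro x ⟨a, ha, -, rfl⟩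
    exact (Complex.nonneg_iff.mp (hpos a ha.posSemidef).det_nonneg).1
  have hscale : ∀ a : Matrix (Fin m) (Fin m) ℂ,
      ((l : ℂ) • a).det = ((d⁻¹ : ℝ) : ℂ) * a.det := by
    intro a
    rw [Matrix.det_smul, Fintype.card_fin, ← Complex.ofReal_pow, hlm]
  have hle : cap (⇑η) ≤ (η ((l : ℂ) • b)).det.re := by
    refine csInf_le hbdd ⟨_, hb.smul (by exact_mod_cast hl), ?_, rfl⟩
    rw [hscale, hdet, ← Complex.ofReal_mul, inv_mul_cancel₀ hd.ne', Complex.ofReal_one]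
  rw [map_smul, hscale, Complex.re_ofReal_mul, inv_mul_eq_div, le_div_iff₀ hd] at hle
  exact hle

/-- If `η` is an indecomposable positive linear map on the `m × m` complex matrices
and the positive definite matrix `c` with `det c = 1` attains the capacity, then the
operator scaling `b ↦ η(c)^(-1/2) * η (c^(1/2) * b * c^(1/2)) * η(c)^(-1/2)` of `η`
is doubly stochastic, i.e. it is unital and (equivalently to its dual mapping `1` to `1`)
trace-preserving.  Here `r` and `s` denote the unique positive definite square roots
of `c` and of `η c`, respectively. -/
theorem stmt5 (m : ℕ)
    (η : Matrix (Fin m) (Fin m) ℂ →ₗ[ℂ] Matrix (Fin m) (Fin m) ℂ)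
    (hpos : ∀ b : Matrix (Fin m) (Fin m) ℂ, b.PosSemidef → (η b).PosSemidef)
    (hind : ∀ b : Matrix (Fin m) (Fin m) ℂ, b.PosSemidef →
        1 ≤ b.rank → b.rank < m → b.rank < (η b).rank)
    (c : Matrix (Fin m) (Fin m) ℂ) (hc : c.PosDef) (hcdet : c.det = 1)
    (hcap : ((η c).det).re = cap (⇑η))
    (r : Matrix (Fin m) (Fin m) ℂ) (hr : r.PosDef) (hrr : r * r = c)
    (s : Matrix (Fin m) (Fin m) ℂ) (hs : s.PosDef) (hss : s * s = η c) :
    s⁻¹ * η (rᴴ * 1 * r) * (s⁻¹)ᴴ = 1 ∧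
    ∀ b : Matrix (Fin m) (Fin m) ℂ,
      (s⁻¹ * η (rᴴ * b * r) * (s⁻¹)ᴴ).trace = b.trace := by
  have hrH : rᴴ = r := hr.isHermitian
  have hsH : (s⁻¹)ᴴ = s⁻¹ := hs.isHermitian.inv
  have hsu : IsUnit s.det := hs.det_pos.ne'.isUnit
  have hunital : s⁻¹ * η (rᴴ * 1 * r) * (s⁻¹)ᴴ = 1 := by
    rw [hrH, hsH, Matrix.mul_one, hrr, ← hss, ← Matrix.mul_assoc, Matrix.nonsing_inv_mul _ hsu,
      Matrix.one_mul, Matrix.mul_nonsing_inv _ hsu]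
  refine ⟨hunital, fun b => ?_⟩
  rcases eq_or_ne m 0 with rfl | hm
  · simp [Matrix.trace]
  let ψ : Matrix (Fin m) (Fin m) ℂ →ₗ[ℂ] Matrix (Fin m) (Fin m) ℂ :=
    LinearMap.mulRight ℂ (s⁻¹)ᴴ ∘ₗ LinearMap.mulLeft ℂ s⁻¹ ∘ₗ η ∘ₗ
      LinearMap.mulRight ℂ r ∘ₗ LinearMap.mulLeft ℂ rᴴ
  have hψ : ∀ a, ψ a = s⁻¹ * η (rᴴ * a * r) * (s⁻¹)ᴴ := fun _ => rfl
  have hψ1 : ψ 1 = 1 := hunital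
  have hdetle : ∀ a : Matrix (Fin m) (Fin m) ℂ, a.PosDef → a.det.re ≤ (ψ a).det.re := by
    intro a ha
    have hra : (rᴴ * a * r).PosDef :=
      ha.conjTranspose_mul_mul_same (Matrix.mulVec_injective_of_isUnit hr.isUnit)
    have hle := det_re_mul_le_of_cap η hpos hm _ hra
    have hdr : (rᴴ * a * r).det = a.det := by
      rw [hrH, Matrix.det_mul, Matrix.det_mul, mul_right_comm, ← Matrix.det_mul, hrr, hcdet,
        one_mul]
    obtain ⟨hσ, hσi⟩ := Complex.pos_iff.mp hs.det_pos
    set σ := s.det.re with hσ_def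
    have hsdet : s.det = (σ : ℂ) := Complex.ext rfl (by simpa using hσi.symm)
    have hηc : (η c).det.re = σ * σ := by
      rw [← hss, Matrix.det_mul, hsdet, ← Complex.ofReal_mul, Complex.ofReal_re]
    have hψa : (η (rᴴ * a * r)).det = ((σ * σ : ℝ) : ℂ) * (ψ a).det := by
      have hσ0 : (σ : ℂ) ≠ 0 := Complex.ofReal_ne_zero.mpr hσ.ne'
      rw [hψ, hsH, Matrix.det_mul, Matrix.det_mul, Matrix.det_nonsing_inv, Ring.inverse_eq_inv',
        hsdet, Complex.ofReal_mul]
      field_simp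
    rw [← hcap, hdr, hηc, hψa, Complex.re_ofReal_mul] at hle
    exact le_of_mul_le_mul_left hle (mul_pos hσ hσ)
  have hψpos : ∀ P : Matrix (Fin m) (Fin m) ℂ, P.PosSemidef → (ψ P).PosSemidef := fun P hP =>
    (hpos _ (hP.conjTranspose_mul_mul_same r)).mul_mul_conjTranspose_same s⁻¹
  let L : Matrix (Fin m) (Fin m) ℂ →ₗ[ℂ] ℂ :=
    Matrix.traceLinearMap (Fin m) ℂ ℂ ∘ₗ ψ - Matrix.traceLinearMap (Fin m) ℂ ℂ
  have hL : ∀ a, L a = (ψ a).trace - a.trace := fun _ => rfl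
  have hL0 := eq_zero_of_nonneg_of_map_one_eq_zero L (fun P hP => ?_) (by rw [hL, hψ1, sub_self]) b
  · rw [hL, sub_eq_zero] at hL0
    exact hL0
  · have hre : P.trace.re ≤ (ψ P).trace.re := by
      refine trace_re_le_of_det_one_add_smul_re_le _ _ fun t ht => ?_
      have hle := hdetle (1 + (t : ℂ) • P)
        (Matrix.PosDef.one.add_posSemidef (hP.smul (by exact_mod_cast ht.le)))
      rwa [map_add, map_smul, hψ1] at hle
    have hi : (ψ P).trace.im = P.trace.im :=
      ((Complex.nonneg_iff.mp (hψpos P hP).trace_nonneg).2).symm.trans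
        (Complex.nonneg_iff.mp hP.trace_nonneg).2
    rw [hL, sub_nonneg, Complex.le_def]
    exact ⟨hre, hi.symm⟩
end

section
/- Let a₁,…,aₙ ∈ Mₘ(ℂ) and define the completely positive maps η(b) := ∑_{i=1}^n aᵢ b aᵢ* and η*(b) := ∑_{i=1}^n aᵢ* b aᵢ on Mₘ(ℂ). Then cap(η*) = cap(η). -/
open ComplexOrder Matrix

open scoped MatrixOrder Matrix.Norms.L2Operator in
theorem Matrix.PosSemidef.exists_eq_conjTranspose_mul_self {m : ℕ}
    {P : Matrix (Fin m) (Fin m) ℂ} (hP : P.PosSemidef) :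
    ∃ B : Matrix (Fin m) (Fin m) ℂ, P = Bᴴ * B :=
  CStarAlgebra.nonneg_iff_eq_star_mul_self.mp hP.nonneg

theorem Matrix.PosSemidef.re_det_le_trace_div_pow {m : ℕ} (hm : m ≠ 0)
    {P : Matrix (Fin m) (Fin m) ℂ} (hP : P.PosSemidef) :
    P.det.re ≤ (P.trace.re / m) ^ m := by
  have hdet : P.det.re = ∏ i, hP.isHermitian.eigenvalues i := by
    rw [hP.isHermitian.det_eq_prod_eigenvalues, ← Complex.ofReal_re (∏ i, _)]
    simp
  have htr : P.trace.re = ∑ i, hP.isHermitian.eigenvalues i := by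
    rw [hP.isHermitian.trace_eq_sum_eigenvalues, ← Complex.ofReal_re (∑ i, _)]
    simp
  rw [hdet, htr]
  have h0 := hP.eigenvalues_nonneg
  have hm' : (0 : ℝ) < m := by positivity
  have key := Real.geom_mean_le_arith_mean Finset.univ (fun _ : Fin m => (1 : ℝ))
    hP.isHermitian.eigenvalues (fun _ _ => zero_le_one) (by simpa using hm') (fun i _ => h0 i)
  simp only [Real.rpow_one, Finset.sum_const, Finset.card_univ, Fintype.card_fin, nsmul_eq_mul,
    mul_one, one_mul] at key
  have hprod : 0 ≤ ∏ i, hP.isHermitian.eigenvalues i := Finset.prod_nonneg fun i _ => h0 i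
  calc _ = ((∏ i, hP.isHermitian.eigenvalues i) ^ (m : ℝ)⁻¹) ^ m :=
        (Real.rpow_inv_natCast_pow hprod hm).symm
    _ ≤ _ := pow_le_pow_left₀ (by positivity) key m

theorem Matrix.PosSemidef.re_det_le_trace_mul_div_pow {m : ℕ} (hm : m ≠ 0)
    {X b : Matrix (Fin m) (Fin m) ℂ} (hX : X.PosSemidef) (hb : b.PosDef) (hb1 : b.det = 1) :
    X.det.re ≤ ((X * b).trace.re / m) ^ m := by
  obtain ⟨B, rfl⟩ := hb.posSemidef.exists_eq_conjTranspose_mul_self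
  have h := (hX.mul_mul_conjTranspose_same B).re_det_le_trace_div_pow hm
  have hdet : (B * X * Bᴴ).det = X.det := by
    rw [det_mul] at hb1
    rw [det_mul, det_mul, mul_right_comm, mul_comm B.det, hb1, one_mul]
  rwa [hdet, mul_assoc, trace_mul_comm, mul_assoc] at h

theorem Matrix.PosDef.exists_det_eq_one_and_trace_mul {m : ℕ} (hm : m ≠ 0)
    {A : Matrix (Fin m) (Fin m) ℂ} (hA : A.PosDef) :
    ∃ c : Matrix (Fin m) (Fin m) ℂ, c.PosDef ∧ c.det = 1 ∧
      ((A * c).trace.re / m) ^ m = A.det.re := by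
  have hpos : 0 < A.det.re := (Complex.pos_iff.mp hA.det_pos).1
  have hre : ((A.det.re : ℝ) : ℂ) = A.det :=
    Complex.ext rfl (Complex.pos_iff.mp hA.det_pos).2
  set r : ℝ := A.det.re ^ (m : ℝ)⁻¹ with hr
  have hr0 : 0 < r := Real.rpow_pos_of_pos hpos _
  have hrm : r ^ m = A.det.re := Real.rpow_inv_natCast_pow hpos.le hm
  have hu : IsUnit A.det := hA.det_pos.ne'.isUnit
  refine ⟨(r : ℂ) • A⁻¹, hA.inv.smul (by exact_mod_cast hr0), ?_, ?_⟩
  · rw [det_smul, Fintype.card_fin, ← Complex.ofReal_pow, hrm, hre, det_nonsing_inv,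
      Ring.mul_inverse_cancel _ hu]
  · rw [mul_smul_comm, mul_nonsing_inv _ hu, trace_smul, trace_one, Fintype.card_fin, ← hrm]
    have : (m : ℝ) ≠ 0 := by exact_mod_cast hm
    simp [this]

theorem posSemidef_sum_mul_mul_conjTranspose {m n : ℕ} (a : Fin n → Matrix (Fin m) (Fin m) ℂ)
    {b : Matrix (Fin m) (Fin m) ℂ} (hb : b.PosSemidef) :
    (∑ i, a i * b * (a i)ᴴ).PosSemidef :=
  Matrix.posSemidef_sum _ fun i _ => hb.mul_mul_conjTranspose_same (a i)

theorem cap_dual_le {m n : ℕ} (hm : m ≠ 0) (a : Fin n → Matrix (Fin m) (Fin m) ℂ) :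
    cap (fun b => ∑ i, (a i)ᴴ * b * a i) ≤ cap (fun b => ∑ i, a i * b * (a i)ᴴ) := by
  have hd {c : Matrix (Fin m) (Fin m) ℂ} (hc : c.PosSemidef) :
      (∑ i, (a i)ᴴ * c * a i).PosSemidef := by
    simpa using posSemidef_sum_mul_mul_conjTranspose (fun i => (a i)ᴴ) hc
  refine le_csInf ⟨_, 1, PosDef.one, det_one, rfl⟩ ?_
  rintro _ ⟨b, hb, hb1, rfl⟩
  set A := ∑ i, a i * b * (a i)ᴴ with hAdef
  have hA : A.PosSemidef := posSemidef_sum_mul_mul_conjTranspose a hb.posSemidef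
  have hcont : Continuous fun δ : ℝ => (A + (δ : ℂ) • (1 : Matrix (Fin m) (Fin m) ℂ)).det.re := by
    fun_prop
  have hlim := (hcont.tendsto 0).mono_left (nhdsWithin_le_nhds (s := Set.Ioi 0))
  simp only [Complex.ofReal_zero, zero_smul, add_zero] at hlim
  refine ge_of_tendsto hlim ?_
  filter_upwards [self_mem_nhdsWithin] with δ (hδ : 0 < δ)
  have hδ1 : ((δ : ℂ) • (1 : Matrix (Fin m) (Fin m) ℂ)).PosDef :=
    PosDef.one.smul (by exact_mod_cast hδ)
  obtain ⟨c, hc, hc1, hct⟩ :=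
    (PosDef.posSemidef_add hA hδ1).exists_det_eq_one_and_trace_mul hm
  have hbdd : BddBelow {x : ℝ | ∃ b : Matrix (Fin m) (Fin m) ℂ,
      b.PosDef ∧ b.det = 1 ∧ ((∑ i, (a i)ᴴ * b * a i).det).re = x} := by
    refine ⟨0, ?_⟩
    rintro _ ⟨c, hc, -, rfl⟩
    exact (Complex.nonneg_iff.mp (hd hc.posSemidef).det_nonneg).1
  refine (csInf_le hbdd ⟨c, hc, hc1, rfl⟩).trans ?_
  have hXc := hd hc.posSemidef
  refine (hXc.re_det_le_trace_mul_div_pow hm hb hb1).trans ?_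
  obtain ⟨B, hB⟩ := hb.posSemidef.exists_eq_conjTranspose_mul_self
  have hnonneg : 0 ≤ ((∑ i, (a i)ᴴ * c * a i) * b).trace.re := by
    rw [hB, ← mul_assoc, trace_mul_comm, ← mul_assoc]
    exact (Complex.nonneg_iff.mp (hXc.mul_mul_conjTranspose_same B).trace_nonneg).1
  have hdual : ((∑ i, (a i)ᴴ * c * a i) * b).trace = (A * c).trace := by
    rw [hAdef, Finset.sum_mul, Finset.sum_mul, trace_sum, trace_sum]
    refine Finset.sum_congr rfl fun i _ => ?_
    rw [mul_assoc, trace_mul_comm, mul_assoc (a i * b)]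
  rw [← hct]
  refine pow_le_pow_left₀ (by positivity) (div_le_div_of_nonneg_right ?_ (by positivity)) m
  have hctr := (Complex.nonneg_iff.mp hc.posSemidef.trace_nonneg).1
  rw [hdual, add_mul, trace_add, smul_mul_assoc, one_mul, trace_smul, smul_eq_mul, Complex.add_re,
    Complex.re_ofReal_mul]
  exact le_add_of_nonneg_right (mul_nonneg hδ.le hctr)

theorem stmt10 (m n : ℕ) (a : Fin n → Matrix (Fin m) (Fin m) ℂ)
    (η ηd : Matrix (Fin m) (Fin m) ℂ → Matrix (Fin m) (Fin m) ℂ)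
    (hη : ∀ b, η b = ∑ i, a i * b * (a i)ᴴ)
    (hηd : ∀ b, ηd b = ∑ i, (a i)ᴴ * b * a i) :
    cap ηd = cap η := by
  obtain rfl | hm := eq_or_ne m 0
  · exact congrArg cap (Subsingleton.elim _ _)
  obtain rfl : η = _ := funext hη
  obtain rfl : ηd = _ := funext hηd
  refine (cap_dual_le hm a).antisymm ?_
  simpa using cap_dual_le hm fun i => (a i)ᴴ
end

section
/- The real integral (1/π) · ∫₀² (log t) · √(4 − t²) dt equals −1/2. -/
open Real in
/-- The integral of `log (2 sin θ)` over a quarter period vanishes. -/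
theorem integral_log_two_mul_sin :
    IntervalIntegrable (fun θ : ℝ => log (2 * sin θ)) MeasureTheory.volume 0 (π / 2) ∧
      ∫ θ in (0:ℝ)..(π / 2), log (2 * sin θ) = 0 := by
  have hs : IntervalIntegrable (fun θ : ℝ => log (sin θ)) MeasureTheory.volume 0 (π / 2) :=
    intervalIntegrable_log_sin
  have hc : IntervalIntegrable (fun _ : ℝ => log 2) MeasureTheory.volume 0 (π / 2) :=
    intervalIntegrable_const
  have h : Set.EqOn (fun θ : ℝ => log 2 + log (sin θ)) (fun θ => log (2 * sin θ))
      (Set.uIoc 0 (π / 2)) := by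
    intro θ hθ
    rw [Set.uIoc_of_le (by positivity)] at hθ
    have := sin_pos_of_pos_of_lt_pi hθ.1 (by linarith [hθ.2, pi_pos])
    exact (log_mul two_ne_zero this.ne').symm
  refine ⟨(hc.add hs).congr h, ?_⟩
  rw [← intervalIntegral.integral_congr_ae (MeasureTheory.ae_of_all _ fun _ hθ => h hθ),
    intervalIntegral.integral_add hc hs, integral_log_sin_zero_pi_div_two]
  simp
  ring

open Real in
/-- The logarithmic integral after the substitution `t = 2 sin θ`. -/
theorem integral_log_two_mul_sin_mul_cos_sq :
    IntervalIntegrable (fun θ : ℝ => log (2 * sin θ) * (4 * cos θ ^ 2))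
        MeasureTheory.volume 0 (π / 2) ∧
      ∫ θ in (0:ℝ)..(π / 2), log (2 * sin θ) * (4 * cos θ ^ 2) = -(π / 2) := by
  obtain ⟨hi, h0⟩ := integral_log_two_mul_sin
  have hint : IntervalIntegrable (fun θ : ℝ => log (2 * sin θ) * (4 * cos θ ^ 2))
      MeasureTheory.volume 0 (π / 2) := hi.mul_continuousOn (by fun_prop)
  refine ⟨hint, ?_⟩
  have hcont : Continuous fun θ : ℝ =>
      cos θ * (2 * sin θ * log (2 * sin θ)) - (θ + sin θ * cos θ) := by
    have : Continuous fun θ : ℝ => 2 * sin θ * log (2 * sin θ) :=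
      continuous_mul_log.comp (by fun_prop : Continuous fun θ : ℝ => 2 * sin θ)
    fun_prop
  have hftc := intervalIntegral.integral_eq_sub_of_hasDerivAt_of_le (a := 0) (b := π / 2)
    (by positivity) hcont.continuousOn
    (f' := fun θ => log (2 * sin θ) * (4 * cos θ ^ 2) - 2 * log (2 * sin θ))
    (fun θ hθ => by
      have hpos := sin_pos_of_pos_of_lt_pi hθ.1 (by linarith [hθ.2, pi_pos])
      have hu : HasDerivAt (fun θ : ℝ => 2 * sin θ) (2 * cos θ) θ :=
        (hasDerivAt_sin θ).const_mul 2
      have hd := ((hasDerivAt_cos θ).mul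
        ((hasDerivAt_mul_log (by positivity : 2 * sin θ ≠ 0)).comp θ hu)).sub
        ((hasDerivAt_id θ).add ((hasDerivAt_sin θ).mul (hasDerivAt_cos θ)))
      refine hd.congr_deriv ?_
      simp only [Function.comp_apply]
      linear_combination (-2 * log (2 * sin θ) + 1) * sin_sq_add_cos_sq θ)
    (hint.sub (hi.const_mul 2))
  rw [intervalIntegral.integral_sub hint (hi.const_mul 2),
    intervalIntegral.integral_const_mul, h0] at hftc
  simpa using hftc

theorem stmt13 :
    (1 / Real.pi) * ∫ t in (0:ℝ)..2, Real.log t * Real.sqrt (4 - t ^ 2)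
      = -(1 / 2) := by
  open Real in
  obtain ⟨hint, hval⟩ := integral_log_two_mul_sin_mul_cos_sq
  have hpi : (0:ℝ) ≤ π / 2 := by positivity
  have hEq : Set.EqOn (fun θ : ℝ => log (2 * sin θ) * (4 * cos θ ^ 2))
      (fun θ => ((fun t => log t * √(4 - t ^ 2)) ∘ fun θ => 2 * sin θ) θ * (2 * cos θ))
      (Set.uIcc 0 (π / 2)) := by
    intro θ hθ
    rw [Set.uIcc_of_le hpi] at hθ
    have hcos := cos_nonneg_of_neg_pi_div_two_le_of_le (by linarith [hθ.1]) hθ.2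
    have hsqrt : √(4 - (2 * sin θ) ^ 2) = 2 * cos θ := by
      rw [show 4 - (2 * sin θ) ^ 2 = (2 * cos θ) ^ 2 by
        linear_combination -4 * sin_sq_add_cos_sq θ]
      exact sqrt_sq (by positivity)
    simp only [Function.comp_apply, hsqrt]
    ring
  have himage : (fun θ => 2 * sin θ) '' Set.uIcc 0 (π / 2) ⊆ Set.Icc 0 2 := by
    rintro _ ⟨θ, hθ, rfl⟩
    rw [Set.uIcc_of_le hpi] at hθ
    have := sin_nonneg_of_nonneg_of_le_pi hθ.1 (by linarith [hθ.2])
    exact ⟨by positivity, by linarith [sin_le_one θ]⟩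
  have hg : MeasureTheory.IntegrableOn (fun t : ℝ => log t * √(4 - t ^ 2)) (Set.Icc 0 2) := by
    have : IntervalIntegrable (fun t : ℝ => log t * √(4 - t ^ 2)) MeasureTheory.volume 0 2 :=
      intervalIntegral.intervalIntegrable_log'.mul_continuousOn (by fun_prop)
    exact (intervalIntegrable_iff_integrableOn_Icc_of_le zero_le_two).1 this
  have hsub := intervalIntegral.integral_comp_mul_deriv''' (a := 0) (b := π / 2)
    (f := fun θ => 2 * sin θ) (f' := fun θ => 2 * cos θ)
    (g := fun t => log t * √(4 - t ^ 2)) (by fun_prop)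
    (fun θ _ => ((hasDerivAt_sin θ).const_mul 2).hasDerivWithinAt)
    (by
      rintro _ ⟨θ, hθ, rfl⟩
      rw [min_eq_left hpi, max_eq_right hpi] at hθ
      have := sin_pos_of_pos_of_lt_pi hθ.1 (by linarith [hθ.2])
      exact ((continuousAt_log (by positivity)).mul
        (by fun_prop)).continuousWithinAt)
    (hg.mono_set himage)
    (by
      rw [Set.uIcc_of_le hpi]
      exact (intervalIntegrable_iff_integrableOn_Icc_of_le hpi).1
        (hint.congr (hEq.mono Set.uIoc_subset_uIcc)))
  rw [← intervalIntegral.integral_congr hEq, hval] at hsub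
  simp only [sin_zero, sin_pi_div_two, mul_zero, mul_one] at hsub
  rw [← hsub]
  field_simp
end
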